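/- arXiv:2005.01695 — 3 statements merged into one kernel-verified Lean document; each statement's English description precedes it below -/
import Mathlib

section
/- Let n, r be natural numbers, let δ ∈ (0,1), and set T = n + 1/2. Then: (1) for all x ∈ [2^{15}·r/n, π], the r-th derivative of D_n satisfies |D_n^{(r)}(x)| ≤ 2^{6}·T^{r}/x; and (2) for every interval I contained in (2^{15}·r·δ^{-1}/n, π] with length |I| = δ/n, there exists a point x_0 ∈ I such that |D_n^{(r)}(x_0)| ≥ 2^{-5}·δ·T^{r}/x_0. -/
open Real

/-- The Dirichlet-type kernel `D_n(x) = ∑_{k=0}^n cos (k x)`. -/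
noncomputable def Dker (n : ℕ) : ℝ → ℝ := fun x => ∑ k ∈ Finset.range (n + 1), Real.cos (k * x)

theorem iteratedDeriv_Dker (n r : ℕ) :
    iteratedDeriv r (Dker n) =
      fun x => ∑ k ∈ Finset.range (n + 1), (k : ℝ) ^ r * cos (k * x + r * (π / 2)) := by
  induction r with
  | zero => ext x; simp [Dker]
  | succ r ih =>
    rw [iteratedDeriv_succ, ih]
    ext x
    refine HasDerivAt.deriv ?_
    refine HasDerivAt.fun_sum fun k _ => ?_
    have h := ((((hasDerivAt_id x).const_mul (k : ℝ)).add_const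
      ((r : ℝ) * (π / 2))).cos).const_mul ((k : ℝ) ^ r)
    refine h.congr_deriv ?_
    have e : (k : ℝ) * x + ((r + 1 : ℕ) : ℝ) * (π / 2) = (k * x + r * (π / 2)) + π / 2 := by
      push_cast; ring
    rw [e, cos_add_pi_div_two]
    simp only [id]
    ring

theorem one_sub_mul_sum_mul_pow (f : ℕ → ℝ) (z : ℂ) (n : ℕ) :
    (1 - z) * ∑ k ∈ Finset.range (n + 1), (f k : ℂ) * z ^ k =
      f 0 + z * ∑ k ∈ Finset.range n, ((f (k + 1) - f k : ℝ) : ℂ) * z ^ k -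
        f n * z ^ (n + 1) := by
  induction n with
  | zero => simp; ring
  | succ n ih =>
    rw [Finset.sum_range_succ, mul_add, ih, Finset.sum_range_succ _ n]
    push_cast
    ring

/-- Abel's inequality for a nonnegative nondecreasing sequence of coefficients. -/
theorem norm_one_sub_mul_sum_mul_pow_le {f : ℕ → ℝ} (hf : Monotone f) (h0 : 0 ≤ f 0)
    {z : ℂ} (hz : ‖z‖ = 1) (n : ℕ) :
    ‖(1 - z) * ∑ k ∈ Finset.range (n + 1), (f k : ℂ) * z ^ k‖ ≤ 2 * f n := by
  have hfn : 0 ≤ f n := h0.trans (hf n.zero_le)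
  have hsum : ‖∑ k ∈ Finset.range n, ((f (k + 1) - f k : ℝ) : ℂ) * z ^ k‖ ≤ f n - f 0 := by
    rw [← Finset.sum_range_sub]
    refine norm_sum_le_of_le _ fun k _ => ?_
    rw [norm_mul, norm_pow, hz, one_pow, mul_one, Complex.norm_real, Real.norm_eq_abs,
      abs_of_nonneg (sub_nonneg.2 (hf k.le_succ))]
  rw [one_sub_mul_sum_mul_pow]
  calc _ ≤ ‖(f 0 : ℂ)‖ + ‖z * ∑ k ∈ Finset.range n, ((f (k + 1) - f k : ℝ) : ℂ) * z ^ k‖ +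
        ‖(f n : ℂ) * z ^ (n + 1)‖ := (norm_sub_le _ _).trans (by gcongr; exact norm_add_le _ _)
    _ ≤ f 0 + (f n - f 0) + f n := by
      simp only [norm_mul, norm_pow, hz, one_pow, mul_one, one_mul, Complex.norm_real,
        Real.norm_eq_abs, abs_of_nonneg h0, abs_of_nonneg hfn]
      gcongr
    _ = 2 * f n := by ring

theorem succ_pow_sub_pow (r k : ℕ) :
    ((k + 1 : ℕ) : ℝ) ^ r - (k : ℝ) ^ r =
      ∑ i ∈ Finset.range r, ((k : ℝ) + 1) ^ i * (k : ℝ) ^ (r - 1 - i) := by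
  have h := geom_sum₂_mul ((k : ℝ) + 1) (k : ℝ) r
  rw [add_sub_cancel_left, mul_one] at h
  rw [h, Nat.cast_succ]

theorem monotone_succ_pow_sub_pow (r : ℕ) :
    Monotone fun k : ℕ => ((k + 1 : ℕ) : ℝ) ^ r - (k : ℝ) ^ r := by
  intro a b hab
  have : (a : ℝ) ≤ b := Nat.cast_le.2 hab
  simp only [succ_pow_sub_pow]
  gcongr

theorem succ_pow_sub_pow_le (r k : ℕ) :
    ((k + 1 : ℕ) : ℝ) ^ r - (k : ℝ) ^ r ≤ r * ((k : ℝ) + 1) ^ (r - 1) := by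
  rw [succ_pow_sub_pow]
  calc _ ≤ ∑ i ∈ Finset.range r, ((k : ℝ) + 1) ^ (r - 1) := by
        refine Finset.sum_le_sum fun i hi => ?_
        have hi' := Finset.mem_range.1 hi
        calc _ ≤ ((k : ℝ) + 1) ^ i * ((k : ℝ) + 1) ^ (r - 1 - i) := by gcongr; linarith
          _ = _ := by rw [← pow_add]; congr 1; omega
    _ = _ := by simp

theorem norm_one_sub_mul_sum_pow_add_le {n r : ℕ} (hn : 1 ≤ n) (hr : 1 ≤ r) {z : ℂ}
    (hz : ‖z‖ = 1) :
    ‖(1 - z) * ((1 - z) * ∑ k ∈ Finset.range (n + 1), (((k : ℝ) ^ r : ℝ) : ℂ) * z ^ k +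
      (n : ℂ) ^ r * z ^ (n + 1))‖ ≤ 2 * (r * (n : ℝ) ^ (r - 1)) := by
  obtain ⟨m, rfl⟩ : ∃ m, n = m + 1 := ⟨n - 1, by omega⟩
  have h := norm_one_sub_mul_sum_mul_pow_le (monotone_succ_pow_sub_pow r)
    (by simp [show r ≠ 0 by omega]) hz m
  have h1 := succ_pow_sub_pow_le r m
  rw [one_sub_mul_sum_mul_pow (fun k => (k : ℝ) ^ r)]
  calc _ = ‖z * ((1 - z) * ∑ k ∈ Finset.range (m + 1),
        ((((k + 1 : ℕ) : ℝ) ^ r - (k : ℝ) ^ r : ℝ) : ℂ) * z ^ k)‖ := by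
        congr 1
        simp only [Nat.cast_zero, zero_pow (show r ≠ 0 by omega)]
        push_cast
        ring
    _ ≤ _ := by
        rw [norm_mul, hz, one_mul]
        push_cast at h h1 ⊢
        linarith

theorem sum_pow_mul_cos_eq_re (n r : ℕ) (x θ : ℝ) :
    ∑ k ∈ Finset.range (n + 1), (k : ℝ) ^ r * cos (k * x + θ) =
      (Complex.exp (θ * Complex.I) * ∑ k ∈ Finset.range (n + 1), (((k : ℝ) ^ r : ℝ) : ℂ) *
        Complex.exp (x * Complex.I) ^ k).re := by
  rw [Finset.mul_sum, Complex.re_sum]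
  refine Finset.sum_congr rfl fun k _ => ?_
  rw [← Complex.exp_nat_mul, mul_left_comm, ← Complex.exp_add, Complex.re_ofReal_mul,
    ← Complex.exp_ofReal_mul_I_re]
  congr 3
  push_cast
  ring

theorem one_sub_exp_mul_I (x : ℝ) :
    1 - Complex.exp (x * Complex.I) =
      -(2 * (sin (x / 2) : ℝ) * Complex.I * Complex.exp ((x / 2 : ℝ) * Complex.I)) := by
  have h : Complex.exp (x * Complex.I) = Complex.exp ((x / 2 : ℝ) * Complex.I) ^ 2 := by
    rw [← Complex.exp_nat_mul]; congr 1; push_cast; ring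
  rw [h, Complex.exp_mul_I, ← Complex.ofReal_cos, ← Complex.ofReal_sin]
  have h2 : ((cos (x / 2) : ℝ) : ℂ) ^ 2 + ((sin (x / 2) : ℝ) : ℂ) ^ 2 = 1 := by
    exact_mod_cast cos_sq_add_sin_sq (x / 2)
  linear_combination -h2 + (((sin (x / 2) : ℝ) : ℂ) ^ 2) * Complex.I_sq

theorem norm_one_sub_exp_mul_I {x : ℝ} (h : 0 ≤ sin (x / 2)) :
    ‖1 - Complex.exp (x * Complex.I)‖ = 2 * sin (x / 2) := by
  rw [one_sub_exp_mul_I, norm_neg, norm_mul, norm_mul, norm_mul, Complex.norm_exp_ofReal_mul_I,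
    Complex.norm_I, Complex.norm_real, Real.norm_eq_abs, abs_of_nonneg h]
  simp

theorem abs_sum_pow_mul_cos_le (n r : ℕ) {x : ℝ} (θ : ℝ) (h : 0 < sin (x / 2)) :
    |∑ k ∈ Finset.range (n + 1), (k : ℝ) ^ r * cos (k * x + θ)| ≤ (n : ℝ) ^ r / sin (x / 2) := by
  have hz := Complex.norm_exp_ofReal_mul_I x
  have hf : Monotone fun k : ℕ => (k : ℝ) ^ r := fun a b hab => by
    have : (a : ℝ) ≤ b := Nat.cast_le.2 hab
    dsimp only
    gcongr
  have hA := norm_one_sub_mul_sum_mul_pow_le hf (by positivity) hz n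
  rw [norm_mul, norm_one_sub_exp_mul_I h.le] at hA
  rw [sum_pow_mul_cos_eq_re, le_div_iff₀ h]
  refine (mul_le_mul_of_nonneg_right (Complex.abs_re_le_norm _) h.le).trans ?_
  rw [norm_mul, Complex.norm_exp_ofReal_mul_I, one_mul]
  linarith

theorem abs_sum_pow_mul_cos_sub_le {n r : ℕ} (hn : 1 ≤ n) (hr : 1 ≤ r) {x : ℝ} (θ : ℝ)
    (h : 0 < sin (x / 2)) :
    |∑ k ∈ Finset.range (n + 1), (k : ℝ) ^ r * cos (k * x + θ) -
      (n : ℝ) ^ r * sin ((n + 1 / 2) * x + θ) / (2 * sin (x / 2))| ≤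
      2 * (r * (n : ℝ) ^ (r - 1)) / (2 * sin (x / 2)) ^ 2 := by
  have hA := norm_one_sub_mul_sum_pow_add_le hn hr (Complex.norm_exp_ofReal_mul_I x)
  have hN := norm_one_sub_exp_mul_I h.le
  set z := Complex.exp (x * Complex.I) with hz
  set S := ∑ k ∈ Finset.range (n + 1), (((k : ℝ) ^ r : ℝ) : ℂ) * z ^ k
  have hs : ((sin (x / 2) : ℝ) : ℂ) ≠ 0 := Complex.ofReal_ne_zero.2 h.ne'
  have hz1 : 1 - z ≠ 0 := by
    rw [← norm_ne_zero_iff, hN]; positivity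
  have hmain : (n : ℝ) ^ r * sin ((n + 1 / 2) * x + θ) / (2 * sin (x / 2)) =
      (Complex.exp (θ * Complex.I) * (-((n : ℂ) ^ r * z ^ (n + 1)) / (1 - z))).re := by
    have e : Complex.exp (θ * Complex.I) * (-((n : ℂ) ^ r * z ^ (n + 1)) / (1 - z)) =
        (((n : ℝ) ^ r / (2 * sin (x / 2)) : ℝ) : ℂ) *
          (-Complex.I * Complex.exp ((((n + 1 / 2) * x + θ : ℝ) : ℂ) * Complex.I)) := by
      have e1 : Complex.exp (θ * Complex.I) * z ^ (n + 1) =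
          Complex.exp ((((n + 1 / 2) * x + θ : ℝ) : ℂ) * Complex.I) *
            Complex.exp ((x / 2 : ℝ) * Complex.I) := by
        rw [hz, ← Complex.exp_nat_mul, ← Complex.exp_add, ← Complex.exp_add]
        congr 1
        push_cast
        ring
      rw [mul_div_assoc', div_eq_iff hz1, hz, one_sub_exp_mul_I]
      rw [show Complex.exp (θ * Complex.I) * -((n : ℂ) ^ r * Complex.exp (x * Complex.I) ^ (n + 1))
        = -((n : ℂ) ^ r * (Complex.exp (θ * Complex.I) * z ^ (n + 1))) by rw [hz]; ring, e1]
      push_cast at hs ⊢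
      field_simp
      rw [Complex.I_sq]
      ring
    rw [e, Complex.re_ofReal_mul, neg_mul, Complex.neg_re, Complex.I_mul_re,
      Complex.exp_ofReal_mul_I_im]
    ring
  rw [sum_pow_mul_cos_eq_re, hmain, ← Complex.sub_re, ← mul_sub]
  refine (Complex.abs_re_le_norm _).trans ?_
  rw [norm_mul, Complex.norm_exp_ofReal_mul_I, one_mul, le_div_iff₀ (by positivity), ← hN,
    ← norm_pow, ← norm_mul]
  refine (congrArg norm ?_).trans_le hA
  change (S - _) * _ = _
  field_simp
  ring

theorem div_pi_le_sin_half {x : ℝ} (h0 : 0 ≤ x) (h1 : x ≤ π) : x / π ≤ sin (x / 2) := by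
  have h := mul_le_sin (x := x / 2) (by linarith) (by linarith)
  calc x / π = 2 / π * (x / 2) := by ring
    _ ≤ _ := h

theorem exists_le_abs_sin {u v : ℝ} (h0 : 0 ≤ v - u) (h1 : v - u ≤ π / 2) :
    (v - u) / π ≤ |sin u| ∨ (v - u) / π ≤ |sin v| := by
  by_contra! h
  have h2 := mul_le_sin h0 h1
  rw [sin_sub] at h2
  have h3 : |sin v * cos u| ≤ |sin v| := by
    rw [abs_mul]; exact mul_le_of_le_one_right (abs_nonneg _) (abs_cos_le_one u)
  have h4 : |cos v * sin u| ≤ |sin u| := by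
    rw [abs_mul]; exact mul_le_of_le_one_left (abs_nonneg _) (abs_cos_le_one v)
  have h5 : 2 / π * (v - u) = (v - u) / π + (v - u) / π := by ring
  have h6 := le_abs_self (sin v * cos u)
  have h7 := neg_abs_le (cos v * sin u)
  linarith [h.1, h.2]

theorem add_half_pow_le {n r : ℕ} (hn : 1 ≤ n) (h : (r : ℝ) ≤ n) :
    ((n : ℝ) + 1 / 2) ^ r ≤ 2 * (n : ℝ) ^ r := by
  have hn' : (1 : ℝ) ≤ n := by exact_mod_cast hn
  have hT : (0 : ℝ) < n + 1 / 2 := by linarith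
  have hB := one_add_mul_le_pow (a := -(1 / (2 * ((n : ℝ) + 1 / 2))))
    (by
      rw [neg_le_neg_iff, div_le_iff₀ (by positivity)]
      linarith) r
  have e : 1 + -(1 / (2 * ((n : ℝ) + 1 / 2))) = n / (n + 1 / 2) := by
    field_simp
    ring
  rw [e, div_pow, le_div_iff₀ (by positivity)] at hB
  have h2 : (1 / 2 : ℝ) ≤ 1 + r * -(1 / (2 * ((n : ℝ) + 1 / 2))) := by
    have : (r : ℝ) * (1 / (2 * ((n : ℝ) + 1 / 2))) ≤ 1 / 2 := by
      rw [mul_one_div, div_le_iff₀ (by positivity)]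
      linarith
    linarith
  have := mul_le_mul_of_nonneg_right h2 (pow_nonneg hT.le r)
  linarith

theorem le_abs_iteratedDeriv_Dker {n r : ℕ} (hn : 1 ≤ n) (hr : 1 ≤ r) {δ x : ℝ}
    (hδ : δ ∈ Set.Ioo (0 : ℝ) 1) (hx : (2 : ℝ) ^ (15 : ℕ) * r * δ⁻¹ / n < x) (hxπ : x ≤ π)
    (hsin : δ / π ≤ |sin (((n : ℝ) + 1 / 2) * x + r * (π / 2))|) :
    ((2 : ℝ) ^ (5 : ℕ))⁻¹ * δ * ((n : ℝ) + 1 / 2) ^ r / x ≤ |iteratedDeriv r (Dker n) x| := by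
  obtain ⟨hδ0, hδ1⟩ := hδ
  have hn' : (1 : ℝ) ≤ n := by exact_mod_cast hn
  have hn0 : (0 : ℝ) < n := by linarith
  have hr' : (1 : ℝ) ≤ r := by exact_mod_cast hr
  have hx0 : 0 < x := lt_trans (by positivity) hx
  have hrx : (2 : ℝ) ^ 15 * r ≤ δ * (n * x) := by
    rw [div_lt_iff₀ hn0, ← div_eq_mul_inv, div_lt_iff₀ hδ0] at hx
    linarith
  have hπ4 : π < 4 := pi_lt_four
  have hrn : (r : ℝ) ≤ n := by
    have h1 : δ * (n * x) ≤ 1 * (n * 4) := by gcongr; linarith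
    linarith
  have hs := div_pi_le_sin_half hx0.le hxπ
  have hs0 : 0 < sin (x / 2) := lt_of_lt_of_le (by positivity) hs
  have hs2 : 2 * sin (x / 2) ≤ x := by linarith [sin_le (x := x / 2) (by linarith)]
  have hE := abs_sum_pow_mul_cos_sub_le hn hr (r * (π / 2)) hs0
  rw [iteratedDeriv_Dker]
  dsimp only
  set D := ∑ k ∈ Finset.range (n + 1), (k : ℝ) ^ r * cos (k * x + r * (π / 2))
  set u := sin (((n : ℝ) + 1 / 2) * x + r * (π / 2))
  have hmain : (n : ℝ) ^ r * (δ / 4) / x ≤ |(n : ℝ) ^ r * u / (2 * sin (x / 2))| := by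
    rw [abs_div, abs_mul, abs_of_nonneg (show (0 : ℝ) ≤ (n : ℝ) ^ r by positivity),
      abs_of_pos (show 0 < 2 * sin (x / 2) by positivity)]
    have : δ / 4 ≤ δ / π := by gcongr
    gcongr
    exact this.trans hsin
  have herr : 2 * (r * (n : ℝ) ^ (r - 1)) / (2 * sin (x / 2)) ^ 2 ≤ (n : ℝ) ^ r * (δ / 16) / x := by
    have hq : x / 4 ≤ sin (x / 2) := le_trans (by gcongr) hs
    have hpow : (n : ℝ) ^ r = (n : ℝ) ^ (r - 1) * n := by
      rw [← pow_succ]; congr 1; omega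
    calc _ ≤ 2 * (r * (n : ℝ) ^ (r - 1)) / (2 * (x / 4)) ^ 2 := by gcongr
      _ = (n : ℝ) ^ (r - 1) * (8 * r) / x ^ 2 := by field_simp; ring
      _ ≤ (n : ℝ) ^ (r - 1) * (δ * (n * x) / 16) / x ^ 2 := by
          gcongr
          linarith
      _ = _ := by rw [hpow]; field_simp
  have hT := add_half_pow_le hn hrn
  have hD : |(n : ℝ) ^ r * u / (2 * sin (x / 2))| - |D| ≤ (n : ℝ) ^ r * (δ / 16) / x :=
    (abs_sub_abs_le_abs_sub _ _).trans (by rw [abs_sub_comm]; exact hE.trans herr)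
  calc _ ≤ ((2 : ℝ) ^ (5 : ℕ))⁻¹ * δ * (2 * (n : ℝ) ^ r) / x := by gcongr
    _ = (n : ℝ) ^ r * (δ / 16) / x := by ring
    _ ≤ (n : ℝ) ^ r * (δ / 4) / x - (n : ℝ) ^ r * (δ / 16) / x := by
        have : 0 ≤ (n : ℝ) ^ r * δ / x := by positivity
        have e1 : (n : ℝ) ^ r * (δ / 4) / x = (n : ℝ) ^ r * δ / x / 4 := by ring
        have e2 : (n : ℝ) ^ r * (δ / 16) / x = (n : ℝ) ^ r * δ / x / 16 := by ring
        rw [e1, e2]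
        linarith
    _ ≤ _ := by linarith

/-- For natural numbers `n, r ≥ 1`, `δ ∈ (0,1)` and `T = n + 1/2`:
(1) for all `x ∈ [2¹⁵ r / n, π]` we have `|D_n^{(r)}(x)| ≤ 2⁶ T^r / x`; and
(2) every interval `I = [a,b] ⊆ (2¹⁵ r δ⁻¹ / n, π]` of length `δ/n` contains a point `x₀`
with `|D_n^{(r)}(x₀)| ≥ 2⁻⁵ δ T^r / x₀`. -/
theorem stmt7 (n r : ℕ) (hn : 1 ≤ n) (hr : 1 ≤ r) (δ : ℝ) (hδ : δ ∈ Set.Ioo (0 : ℝ) 1) :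
    (∀ x : ℝ, (2 : ℝ) ^ (15 : ℕ) * r / n ≤ x → x ≤ π →
      |iteratedDeriv r (Dker n) x| ≤ 2 ^ (6 : ℕ) * ((n : ℝ) + 1 / 2) ^ r / x) ∧
    (∀ a b : ℝ, (2 : ℝ) ^ (15 : ℕ) * r * δ⁻¹ / n < a → a ≤ b → b ≤ π → b - a = δ / n →
      ∃ x₀ ∈ Set.Icc a b,
        ((2 : ℝ) ^ (5 : ℕ))⁻¹ * δ * ((n : ℝ) + 1 / 2) ^ r / x₀ ≤
          |iteratedDeriv r (Dker n) x₀|) := by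
  have hn' : (1 : ℝ) ≤ n := by exact_mod_cast hn
  have hn0 : (0 : ℝ) < n := by linarith
  have hr' : (1 : ℝ) ≤ r := by exact_mod_cast hr
  refine ⟨fun x hx hxπ => ?_, fun a b ha hab hb hI => ?_⟩
  · have hx0 : 0 < x := lt_of_lt_of_le (by positivity) hx
    have hs := div_pi_le_sin_half hx0.le hxπ
    have hs0 : 0 < sin (x / 2) := lt_of_lt_of_le (by positivity) hs
    rw [iteratedDeriv_Dker]
    calc _ ≤ (n : ℝ) ^ r / sin (x / 2) := abs_sum_pow_mul_cos_le n r _ hs0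
      _ ≤ (n : ℝ) ^ r / (x / π) := by gcongr
      _ = π * (n : ℝ) ^ r / x := by field_simp
      _ ≤ _ := by
        gcongr
        · linarith [pi_lt_four]
        · linarith
  · have hδ0 := hδ.1
    have hlen : ((n + 1 / 2) * b + r * (π / 2)) - ((n + 1 / 2) * a + r * (π / 2)) =
        δ * (1 + 1 / (2 * n)) := by
      rw [show ((n + 1 / 2) * b + r * (π / 2)) - ((n + 1 / 2) * a + r * (π / 2)) =
        ((n : ℝ) + 1 / 2) * (b - a) by ring, hI]
      field_simp
    have hle : 1 / (2 * (n : ℝ)) ≤ 1 / 2 := by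
      gcongr
      linarith
    have hge : 0 ≤ 1 / (2 * (n : ℝ)) := by positivity
    have hlow : δ ≤ δ * (1 + 1 / (2 * n)) := le_mul_of_one_le_right hδ0.le (by linarith)
    have hup : δ * (1 + 1 / (2 * n)) ≤ 1 * (1 + 1 / 2) := by
      gcongr
      exact hδ.2.le
    have hdiv : δ / π ≤ δ * (1 + 1 / (2 * n)) / π := by gcongr
    rcases exists_le_abs_sin (u := (n + 1 / 2) * a + r * (π / 2))
      (v := (n + 1 / 2) * b + r * (π / 2)) (by linarith) (by linarith [pi_gt_three]) with h | h
    · rw [hlen] at h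
      exact ⟨a, ⟨le_rfl, hab⟩,
        le_abs_iteratedDeriv_Dker hn hr hδ ha (hab.trans hb) (hdiv.trans h)⟩
    · rw [hlen] at h
      exact ⟨b, ⟨hab, le_rfl⟩,
        le_abs_iteratedDeriv_Dker hn hr hδ (ha.trans_le hab) hb (hdiv.trans h)⟩
end

section
/- There exists an absolute constant c > 0 and, for each α ∈ (0,1), a constant C_α > 0 depending only on α, such that the following holds. Let n be a natural number and let f = D_n − g, where g is a {0,1}-cosine polynomial with deg(g) = m ≤ n^{1−α}. Then (n/(2π))·|E(g)| − c·m ≤ Z(f) ≤ C_α·(n·|E(g)| + m) + c·n^{0.6}, where |E(g)| denotes the Lebesgue measure of E(g). -/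
open Real MeasureTheory

/-- `zeros f S` : the number of zeros of `f` in the set `S`. -/
noncomputable def zeros (f : ℝ → ℝ) (S : Set ℝ) : ℕ := {x ∈ S | f x = 0}.ncard

/-- `s(x) = 1 / (2 sin (x/2))`. -/
noncomputable def sfun (x : ℝ) : ℝ := (2 * Real.sin (x / 2))⁻¹

/-- The set `E(g) = {x ∈ (0, π] : |g(x) - 1/2| < s(x)}`. -/
def Eset (g : ℝ → ℝ) : Set ℝ := {x ∈ Set.Ioc (0 : ℝ) π | |g x - 1 / 2| < sfun x}

/-- The cosine polynomial `∑_{k ≤ m} ε_k cos (k x)`. -/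
noncomputable def cosSum (m : ℕ) (ε : ℕ → ℝ) (x : ℝ) : ℝ :=
  ∑ k ∈ Finset.range (m + 1), ε k * Real.cos (k * x)

/-- The comparison function `2 sin (x/2) (g x - 1/2)` for `g = cosSum m ε`. -/
noncomputable def profile (m : ℕ) (ε : ℕ → ℝ) (x : ℝ) : ℝ :=
  2 * Real.sin (x / 2) * (cosSum m ε x - 1 / 2)

theorem continuous_cosSum (m : ℕ) (ε : ℕ → ℝ) : Continuous (cosSum m ε) := by
  unfold cosSum; fun_prop

theorem continuous_profile (m : ℕ) (ε : ℕ → ℝ) : Continuous (profile m ε) := by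
  have := continuous_cosSum m ε
  unfold profile; fun_prop

open Polynomial in
theorem exists_polynomial_eval_cos (m : ℕ) (ε : ℕ → ℝ) :
    ∃ P : ℝ[X], P.natDegree ≤ m ∧ ∀ x, P.eval (Real.cos x) = cosSum m ε x := by
  refine ⟨∑ k ∈ Finset.range (m + 1), C (ε k) * Chebyshev.T ℝ k, ?_, fun x => ?_⟩
  · refine natDegree_sum_le_of_forall_le _ _ fun k hk => (natDegree_C_mul_le _ _).trans ?_
    simpa using Nat.lt_succ_iff.mp (Finset.mem_range.mp hk)
  · simp [cosSum, eval_finsetSum]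

open Polynomial in
theorem finite_zeros_eval_cos {P : ℝ[X]} (hP : P ≠ 0) :
    {x ∈ Set.Icc 0 π | P.eval (Real.cos x) = 0}.Finite ∧
      {x ∈ Set.Icc 0 π | P.eval (Real.cos x) = 0}.ncard ≤ P.natDegree := by
  have hinj : Set.InjOn Real.cos {x ∈ Set.Icc 0 π | P.eval (Real.cos x) = 0} :=
    Real.injOn_cos.mono fun x hx => hx.1
  have hsub : Real.cos '' {x ∈ Set.Icc 0 π | P.eval (Real.cos x) = 0} ⊆ P.roots.toFinset := by
    rintro _ ⟨x, hx, rfl⟩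
    simpa [hP] using hx.2
  refine ⟨Set.Finite.of_finite_image (P.roots.toFinset.finite_toSet.subset hsub) hinj, ?_⟩
  rw [← hinj.ncard_image]
  calc _ ≤ (P.roots.toFinset : Set ℝ).ncard := Set.ncard_le_ncard hsub (Finset.finite_toSet _)
    _ = P.roots.toFinset.card := Set.ncard_coe_finset _
    _ ≤ P.roots.card := Multiset.toFinset_card_le _
    _ ≤ P.natDegree := card_roots' P

open Polynomial in
theorem finite_abs_profile_eq_one (m : ℕ) (ε : ℕ → ℝ) :
    {x ∈ Set.Icc 0 π | |profile m ε x| = 1}.Finite ∧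
      {x ∈ Set.Icc 0 π | |profile m ε x| = 1}.ncard ≤ 2 * m + 1 := by
  obtain ⟨G, hG, hGe⟩ := exists_polynomial_eval_cos m ε
  set Q : ℝ[X] := (2 - 2 * X) * (G - C (1 / 2)) ^ 2 - 1 with hQ
  have hQe : ∀ x, Q.eval (Real.cos x) = profile m ε x ^ 2 - 1 := fun x => by
    have h : Real.cos x = 1 - 2 * Real.sin (x / 2) ^ 2 := by
      have := Real.cos_two_mul (x / 2)
      rw [mul_div_cancel₀ x two_ne_zero] at this
      linarith [Real.sin_sq_add_cos_sq (x / 2)]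
    simp only [hQ, eval_sub, eval_mul, eval_pow, hGe, eval_C, eval_X, eval_ofNat, eval_one, profile]
    rw [h]; ring
  have hQ0 : Q ≠ 0 := by
    intro h
    have := hQe 0
    simp [h, profile] at this
  have hdeg : Q.natDegree ≤ 2 * m + 1 := by
    have h1 : (2 - 2 * X : ℝ[X]).natDegree ≤ 1 := by compute_degree
    have h2 : (G - C (1 / 2)).natDegree ≤ m := by
      rw [natDegree_sub_C]; exact hG
    have h3 : ((G - C (1 / 2)) ^ 2).natDegree ≤ 2 * m :=
      natDegree_pow_le.trans (Nat.mul_le_mul_left 2 h2)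
    refine (natDegree_sub_le _ _).trans (max_le ?_ (by simp))
    exact natDegree_mul_le.trans (by omega)
  have hset : {x ∈ Set.Icc 0 π | |profile m ε x| = 1} =
      {x ∈ Set.Icc 0 π | Q.eval (Real.cos x) = 0} := by
    ext x
    simp only [Set.mem_ofPred_eq, hQe, sub_eq_zero, ← sq_abs (profile m ε x)]
    refine and_congr_right fun _ => ⟨fun h => by rw [h]; norm_num, fun h => ?_⟩
    exact (pow_eq_one_iff_of_nonneg (abs_nonneg _) two_ne_zero).mp h
  rw [hset]
  exact ⟨(finite_zeros_eval_cos hQ0).1, (finite_zeros_eval_cos hQ0).2.trans hdeg⟩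

theorem telescope_sin (n : ℕ) (x : ℝ) :
    2 * Real.sin (x / 2) * Dker n x = Real.sin ((n + 1 / 2) * x) + Real.sin (x / 2) := by
  unfold Dker
  induction n with
  | zero => simp; ring_nf
  | succ n ih =>
    rw [Finset.sum_range_succ, mul_add, ih]
    have h1 := Real.sin_add ((n + 1 : ℕ) * x) (x / 2)
    have h2 := Real.sin_sub ((n + 1 : ℕ) * x) (x / 2)
    push_cast at *
    rw [show ((n : ℝ) + 1 + 1 / 2) * x = (n + 1) * x + x / 2 by ring,
      show ((n : ℝ) + 1 / 2) * x = (n + 1) * x - x / 2 by ring]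
    linarith

theorem two_sin_mul_sub (n m : ℕ) (ε : ℕ → ℝ) (x : ℝ) :
    2 * Real.sin (x / 2) * (Dker n x - cosSum m ε x) =
      Real.sin ((n + 1 / 2) * x) - profile m ε x := by
  rw [mul_sub, telescope_sin, profile]; ring

theorem two_sin_half_pos {x : ℝ} (h0 : 0 < x) (h1 : x ≤ π) : 0 < 2 * Real.sin (x / 2) :=
  mul_pos two_pos (Real.sin_pos_of_pos_of_lt_pi (by linarith) (by linarith [Real.pi_pos]))

theorem Eset_cosSum (m : ℕ) (ε : ℕ → ℝ) :
    Eset (cosSum m ε) = {x ∈ Set.Ioc 0 π | |profile m ε x| < 1} := by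
  ext x
  refine and_congr_right fun hx => ?_
  have hs := two_sin_half_pos hx.1 hx.2
  rw [sfun, profile, abs_mul, abs_of_pos hs, ← one_div, lt_div_iff₀ hs, mul_comm]

theorem sub_eq_zero_iff_profile (n m : ℕ) (ε : ℕ → ℝ) {x : ℝ} (h0 : 0 < x) (h1 : x ≤ π) :
    Dker n x - cosSum m ε x = 0 ↔ Real.sin ((n + 1 / 2) * x) = profile m ε x := by
  rw [← sub_eq_zero (a := Real.sin _), ← two_sin_mul_sub,
    mul_eq_zero_iff_left (two_sin_half_pos h0 h1).ne']

theorem exists_abs_profile_eq_one {m : ℕ} {ε : ℕ → ℝ} {S : Set ℝ} (hS : IsPreconnected S)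
    {x y : ℝ} (hx : x ∈ S) (hy : y ∈ S) (hx1 : |profile m ε x| ≤ 1) (hy1 : 1 ≤ |profile m ε y|) :
    ∃ z ∈ S, |profile m ε z| = 1 :=
  hS.intermediate_value hx hy (continuous_profile m ε).abs.continuousOn ⟨hx1, hy1⟩

open Polynomial in
theorem finite_zeros_sub {n m : ℕ} {ε : ℕ → ℝ} (hne : ∃ x, Dker n x - cosSum m ε x ≠ 0)
    (hmn : m ≤ n) :
    {x ∈ Set.Icc 0 π | Dker n x - cosSum m ε x = 0}.Finite ∧
      {x ∈ Set.Icc 0 π | Dker n x - cosSum m ε x = 0}.ncard ≤ n := by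
  obtain ⟨G, hG, hGe⟩ := exists_polynomial_eval_cos m ε
  obtain ⟨D, hD, hDe⟩ := exists_polynomial_eval_cos n 1
  have he : ∀ x, (D - G).eval (Real.cos x) = Dker n x - cosSum m ε x := fun x => by
    rw [eval_sub, hGe, hDe]; simp [cosSum, Dker]
  have h0 : D - G ≠ 0 := by
    rintro h
    obtain ⟨x, hx⟩ := hne
    rw [← he, h, eval_zero] at hx
    exact hx rfl
  simp only [← he]
  refine ⟨(finite_zeros_eval_cos h0).1, (finite_zeros_eval_cos h0).2.trans ?_⟩
  exact (natDegree_sub_le _ _).trans (max_le hD (hG.trans hmn))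

theorem sub_reflect (n m : ℕ) (ε : ℕ → ℝ) (x : ℝ) :
    Dker n (2 * π - x) - cosSum m ε (2 * π - x) = Dker n x - cosSum m ε x := by
  have h : ∀ k : ℕ, Real.cos (k * (2 * π - x)) = Real.cos (k * x) := fun k => by
    rw [mul_sub, Real.cos_nat_mul_two_pi_sub]
  simp [Dker, cosSum, h]

theorem zeros_le_two_mul {n m : ℕ} {ε : ℕ → ℝ} (hne : ∃ x, Dker n x - cosSum m ε x ≠ 0)
    (hmn : m ≤ n) :
    {x ∈ Set.Icc 0 π | Dker n x - cosSum m ε x = 0}.ncard ≤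
        zeros (fun x => Dker n x - cosSum m ε x) (Set.Icc 0 (2 * π)) ∧
      zeros (fun x => Dker n x - cosSum m ε x) (Set.Icc 0 (2 * π)) ≤
        2 * {x ∈ Set.Icc 0 π | Dker n x - cosSum m ε x = 0}.ncard := by
  have hfin := (finite_zeros_sub hne hmn).1
  set A := {x ∈ Set.Icc 0 π | Dker n x - cosSum m ε x = 0}
  have hsub : {x ∈ Set.Icc 0 (2 * π) | Dker n x - cosSum m ε x = 0} ⊆
      A ∪ (fun x => 2 * π - x) '' A := by
    rintro x ⟨⟨hx0, hx1⟩, hx⟩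
    rcases le_total x π with h | h
    · exact Or.inl ⟨⟨hx0, h⟩, hx⟩
    · exact Or.inr ⟨2 * π - x, ⟨⟨by linarith, by linarith⟩, by rw [sub_reflect]; exact hx⟩, by simp⟩
  have hfin' := hfin.union (hfin.image fun x => 2 * π - x)
  constructor
  · refine Set.ncard_le_ncard ?_ (hfin'.subset hsub)
    exact fun x hx => ⟨⟨hx.1.1, by linarith [hx.1.2, Real.pi_pos]⟩, hx.2⟩
  · calc _ ≤ (A ∪ (fun x => 2 * π - x) '' A).ncard := Set.ncard_le_ncard hsub hfin'
      _ ≤ A.ncard + ((fun x => 2 * π - x) '' A).ncard := Set.ncard_union_le _ _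
      _ ≤ A.ncard + A.ncard := Nat.add_le_add_left (Set.ncard_image_le hfin) _
      _ = _ := by ring

theorem sub_apply_zero_pos {n m : ℕ} {ε : ℕ → ℝ} (hε : ∀ k, ε k = 0 ∨ ε k = 1) (hmn : m < n) :
    0 < Dker n 0 - cosSum m ε 0 := by
  have h : ∑ k ∈ Finset.range (m + 1), ε k ≤ ∑ k ∈ Finset.range (m + 1), (1 : ℝ) :=
    Finset.sum_le_sum fun k _ => by rcases hε k with h | h <;> simp [h]
  have h' : (m : ℝ) < n := mod_cast hmn
  simp [Dker, cosSum] at h ⊢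
  linarith

theorem card_le_ncard_of_forall_exists {J : Finset ℕ} {A : Set ℝ} (hA : A.Finite) (φ : ℝ → ℕ)
    (h : ∀ k ∈ J, ∃ z ∈ A, φ z = k) : J.card ≤ A.ncard := by
  rw [← Set.ncard_coe_finset]
  exact (Set.ncard_le_ncard h (hA.image φ)).trans (Set.ncard_image_le hA)

theorem exists_zero_between {n m k : ℕ} {ε : ℕ → ℝ} (hk : k < n)
    (h0 : |profile m ε ((k + 1 / 2) * (π / (n + 1 / 2)))| < 1)
    (h1 : |profile m ε ((k + 1 + 1 / 2) * (π / (n + 1 / 2)))| ≤ 1) :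
    ∃ z ∈ {x ∈ Set.Icc 0 π | Dker n x - cosSum m ε x = 0},
      (k + 1 / 2) * (π / (n + 1 / 2)) < z ∧ z ≤ (k + 1 + 1 / 2) * (π / (n + 1 / 2)) := by
  have hN : (0 : ℝ) < n + 1 / 2 := by positivity
  set δ := π / (n + 1 / 2 : ℝ) with hδ
  have hδ0 : 0 < δ := div_pos Real.pi_pos hN
  have hNδ : (n + 1 / 2 : ℝ) * δ = π := mul_div_cancel₀ _ hN.ne'
  have hsin : ∀ j : ℕ, Real.sin ((n + 1 / 2) * ((j + 1 / 2) * δ)) = (-1) ^ j := fun j => by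
    rw [show (n + 1 / 2 : ℝ) * ((j + 1 / 2) * δ) = j * π + π / 2 by
      rw [mul_left_comm, hNδ]; ring, Real.sin_add_pi_div_two, Real.cos_nat_mul_pi]
  have hs0 := hsin k
  have hs1 := hsin (k + 1)
  push_cast at hs1
  have hcont : Continuous fun x => (-1) ^ k * (Real.sin ((n + 1 / 2) * x) - profile m ε x) := by
    have := continuous_profile m ε
    fun_prop
  have hle : (k + 1 / 2) * δ ≤ (k + 1 + 1 / 2) * δ := by gcongr; linarith
  have hsq : ((-1 : ℝ) ^ k) * (-1) ^ k = 1 := by rw [← mul_pow]; norm_num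
  have habs : ∀ y : ℝ, |(-1) ^ k * y| = |y| := fun y => by simp [abs_mul]
  have hpos : 0 < (-1) ^ k * (Real.sin ((n + 1 / 2) * ((k + 1 / 2) * δ)) -
      profile m ε ((k + 1 / 2) * δ)) := by
    rw [hs0, mul_sub, hsq]
    rw [← habs] at h0
    linarith [(abs_lt.mp h0).2]
  have hnonpos : (-1) ^ k * (Real.sin ((n + 1 / 2) * ((k + 1 + 1 / 2) * δ)) -
      profile m ε ((k + 1 + 1 / 2) * δ)) ≤ 0 := by
    rw [hs1, mul_sub, pow_succ, ← mul_assoc, hsq]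
    rw [← habs] at h1
    linarith [(abs_le.mp h1).1]
  obtain ⟨z, hz, hz0⟩ := intermediate_value_Icc' hle hcont.continuousOn ⟨hnonpos, hpos.le⟩
  have hzlt : (k + 1 / 2) * δ < z := lt_of_le_of_ne hz.1 fun h => by
    rw [← h] at hz0
    exact hpos.ne' hz0
  have hkn : (k : ℝ) + 1 ≤ n := mod_cast hk
  have hzpos : 0 < z := lt_trans (by positivity) hzlt
  have hzpi : z ≤ π := hz.2.trans (by rw [← hNδ]; gcongr)
  refine ⟨z, ⟨⟨hzpos.le, hzpi⟩, ?_⟩, hzlt, hz.2⟩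
  rw [sub_eq_zero_iff_profile _ _ _ hzpos hzpi, ← sub_eq_zero]
  exact (mul_eq_zero.mp hz0).resolve_left (by simp)

theorem card_le_ncard_zeros {n m : ℕ} {ε : ℕ → ℝ} {J : Finset ℕ}
    (hfin : {x ∈ Set.Icc 0 π | Dker n x - cosSum m ε x = 0}.Finite)
    (hJ : ∀ k ∈ J, k < n ∧ |profile m ε ((k + 1 / 2) * (π / (n + 1 / 2)))| < 1 ∧
      |profile m ε ((k + 1 + 1 / 2) * (π / (n + 1 / 2)))| ≤ 1) :
    J.card ≤ {x ∈ Set.Icc 0 π | Dker n x - cosSum m ε x = 0}.ncard := by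
  have hδ0 : 0 < π / (n + 1 / 2 : ℝ) := by positivity
  refine card_le_ncard_of_forall_exists hfin
    (fun z => ⌈z / (π / (n + 1 / 2)) - 1 / 2⌉₊ - 1) fun k hk => ?_
  obtain ⟨hkn, h0, h1⟩ := hJ k hk
  obtain ⟨z, hz, hz0, hz1⟩ := exists_zero_between hkn h0 h1
  refine ⟨z, hz, ?_⟩
  rw [← lt_div_iff₀ hδ0] at hz0
  rw [← div_le_iff₀ hδ0] at hz1
  have : ⌈z / (π / (n + 1 / 2)) - 1 / 2⌉₊ = k + 1 := by
    rw [Nat.ceil_eq_iff (by simp)]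
    push_cast
    constructor <;> simp <;> linarith
  simp only [this, Nat.add_sub_cancel]

theorem volume_Eset_le {n m : ℕ} {ε : ℕ → ℝ}
    (hfin : {x ∈ Set.Icc 0 π | Dker n x - cosSum m ε x = 0}.Finite) :
    (volume (Eset (cosSum m ε))).toReal ≤ π / (n + 1 / 2) *
      ({x ∈ Set.Icc 0 π | Dker n x - cosSum m ε x = 0}.ncard + (2 * m + 1) + 1 / 2) := by
  classical
  have hN : (0 : ℝ) < n + 1 / 2 := by positivity
  set δ := π / (n + 1 / 2 : ℝ) with hδ
  have hδ0 : 0 < δ := div_pos Real.pi_pos hN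
  have hNδ : (n + 1 / 2 : ℝ) * δ = π := mul_div_cancel₀ _ hN.ne'
  rw [Eset_cosSum]
  set E := {x ∈ Set.Ioc 0 π | |profile m ε x| < 1} with hE
  set cell : ℕ → Set ℝ := fun k => Set.Ico ((k + 1 / 2) * δ) ((k + 1 + 1 / 2) * δ) with hcell
  set J := (Finset.range n).filter fun k => (E ∩ cell k).Nonempty with hJ
  have hcover : E ⊆ (Set.Icc 0 (1 / 2 * δ) ∪ {π}) ∪ ⋃ k ∈ J, cell k := by
    intro x hx
    rcases eq_or_lt_of_le hx.1.2 with h | h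
    · exact Or.inl (Or.inr h)
    rcases le_or_gt x (1 / 2 * δ) with h' | h'
    · exact Or.inl (Or.inl ⟨hx.1.1.le, h'⟩)
    right
    have hy0 : 0 ≤ x / δ - 1 / 2 := by
      rw [sub_nonneg, le_div_iff₀ hδ0]; exact h'.le
    have hyn : x / δ - 1 / 2 < n := by
      rw [sub_lt_iff_lt_add, div_lt_iff₀ hδ0, hNδ]; exact h
    have hxc : x ∈ cell ⌊x / δ - 1 / 2⌋₊ := by
      refine ⟨?_, ?_⟩
      · rw [← le_div_iff₀ hδ0]; linarith [Nat.floor_le hy0]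
      · rw [← div_lt_iff₀ hδ0]; linarith [Nat.lt_floor_add_one (x / δ - 1 / 2)]
    refine Set.mem_biUnion (x := ⌊x / δ - 1 / 2⌋₊) ?_ hxc
    exact Finset.mem_filter.mpr
      ⟨Finset.mem_range.mpr ((Nat.floor_lt hy0).mpr hyn), x, hx, hxc⟩
  have hcellvol : ∀ k, volume.real (cell k) = δ := fun k => by
    rw [hcell, Real.volume_real_Ico_of_le (by gcongr; linarith)]; ring
  have hfinite : volume ((Set.Icc 0 (1 / 2 * δ) ∪ {π}) ∪ ⋃ k ∈ J, cell k) ≠ ⊤ := by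
    refine measure_union_ne_top (measure_union_ne_top measure_Icc_lt_top.ne (by simp)) ?_
    refine (measure_biUnion_lt_top J.finite_toSet fun k _ => ?_).ne
    simp [hcell]
  have hvol : volume.real E ≤ 1 / 2 * δ + J.card * δ := by
    calc volume.real E ≤ _ := measureReal_mono hcover hfinite
      _ ≤ _ := measureReal_union_le _ _
      _ ≤ (volume.real (Set.Icc 0 (1 / 2 * δ)) + volume.real {π}) +
          ∑ k ∈ J, volume.real (cell k) :=
        add_le_add (measureReal_union_le _ _) (measureReal_biUnion_finset_le _ _)
      _ = _ := by
        simp only [hcellvol, Finset.sum_const, nsmul_eq_mul]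
        rw [Real.volume_real_Icc_of_le (by positivity)]
        simp [measureReal_def]
  set good : ℕ → Prop := fun k => |profile m ε ((k + 1 / 2) * δ)| < 1 ∧
    |profile m ε ((k + 1 + 1 / 2) * δ)| ≤ 1
  have hgood : (J.filter good).card ≤
      {x ∈ Set.Icc 0 π | Dker n x - cosSum m ε x = 0}.ncard := by
    refine card_le_ncard_zeros hfin fun k hk => ?_
    simp only [hJ, Finset.mem_filter, Finset.mem_range] at hk
    exact ⟨hk.1.1, hk.2⟩
  have hbad : (J.filter fun k => ¬ good k).card ≤ 2 * m + 1 := by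
    refine (card_le_ncard_of_forall_exists (finite_abs_profile_eq_one m ε).1
      (fun z => ⌊z / δ - 1 / 2⌋₊) fun k hk => ?_).trans (finite_abs_profile_eq_one m ε).2
    simp only [hJ, Finset.mem_filter, Finset.mem_range] at hk
    obtain ⟨⟨hkn, x, hxE, hxc⟩, hng⟩ := hk
    have hlt : ((k : ℝ) + 1 / 2) * δ < (k + 1 + 1 / 2) * δ := by gcongr; linarith
    have hz : ∃ z ∈ cell k, |profile m ε z| = 1 := by
      by_cases h0 : |profile m ε ((k + 1 / 2) * δ)| < 1
      · have h1 : 1 < |profile m ε ((k + 1 + 1 / 2) * δ)| := not_le.mp fun h => hng ⟨h0, h⟩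
        obtain ⟨z, hz, hz1⟩ := exists_abs_profile_eq_one isPreconnected_Icc
          (Set.left_mem_Icc.mpr hlt.le) (Set.right_mem_Icc.mpr hlt.le) h0.le h1.le
        exact ⟨z, ⟨hz.1, lt_of_le_of_ne hz.2 fun h => h1.ne' (h ▸ hz1)⟩, hz1⟩
      · exact exists_abs_profile_eq_one isPreconnected_Ico hxc (Set.left_mem_Ico.mpr hlt)
          hxE.2.le (not_lt.mp h0)
    obtain ⟨z, hzc, hz1⟩ := hz
    have hkn' : (k : ℝ) + 1 ≤ n := mod_cast hkn
    refine ⟨z, ⟨⟨le_trans (by positivity) hzc.1, hzc.2.le.trans ?_⟩, hz1⟩, ?_⟩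
    · rw [← hNδ]; gcongr
    · have h0 := hzc.1
      have h1 := hzc.2
      rw [← le_div_iff₀ hδ0] at h0
      rw [← div_lt_iff₀ hδ0] at h1
      rw [Nat.floor_eq_iff (by linarith [Nat.cast_nonneg (α := ℝ) k])]
      constructor <;> linarith
  have hcard : (J.card : ℝ) ≤
      {x ∈ Set.Icc 0 π | Dker n x - cosSum m ε x = 0}.ncard + (2 * m + 1) := by
    rw [← Finset.card_filter_add_card_filter_not good]
    exact mod_cast add_le_add hgood hbad
  rw [measureReal_def] at hvol
  nlinarith

theorem abs_profile_zero_le_one {ε : ℕ → ℝ} (hε : ∀ k, ε k = 0 ∨ ε k = 1) {x : ℝ}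
    (h0 : 0 < x) (h1 : x ≤ π) : |profile 0 ε x| ≤ 1 ∧ (x < π → |profile 0 ε x| < 1) := by
  have hp : |profile 0 ε x| = Real.sin (x / 2) := by
    rw [profile, abs_mul, abs_of_pos (two_sin_half_pos h0 h1)]
    have : |cosSum 0 ε x - 1 / 2| = 1 / 2 := by
      rcases hε 0 with h | h <;> norm_num [cosSum, h, abs_of_pos]
    rw [this]; ring
  rw [hp]
  refine ⟨Real.sin_le_one _, fun h => ?_⟩
  rw [← Real.sin_pi_div_two]
  exact Real.sin_lt_sin_of_lt_of_le_pi_div_two (by linarith) le_rfl (by linarith)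

theorem exists_card_zeros_deriv {F F' : ℝ → ℝ} (hF : ∀ x, HasDerivAt F (F' x) x) {a b : ℝ}
    {s : Finset ℝ} {j : ℕ} (hs : ∀ x ∈ s, x ∈ Set.Icc a b ∧ F x = 0) (hj : j + 1 = s.card) :
    ∃ t : Finset ℝ, (∀ x ∈ t, x ∈ Set.Icc a b ∧ F' x = 0) ∧ t.card = j := by
  set e := s.orderEmbOfFin hj.symm
  have he : ∀ i, e i ∈ Set.Icc a b ∧ F (e i) = 0 := fun i => hs _ (s.orderEmbOfFin_mem hj.symm i)
  have hrolle : ∀ i : Fin j, ∃ c ∈ Set.Ioo (e i.castSucc) (e i.succ), F' c = 0 := fun i =>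
    exists_hasDerivAt_eq_zero (e.strictMono i.castSucc_lt_succ)
      (fun x _ => (hF x).continuousAt.continuousWithinAt) ((he _).2.trans (he _).2.symm)
      fun x _ => hF x
  choose c hc hc0 using hrolle
  have hmono : StrictMono c := fun i k hik =>
    calc c i < e i.succ := (hc i).2
      _ ≤ e k.castSucc := e.monotone (Fin.le_def.mpr (by simpa using Fin.lt_def.mp hik))
      _ < c k := (hc k).1
  refine ⟨Finset.univ.image c, fun x hx => ?_, ?_⟩
  · obtain ⟨i, -, rfl⟩ := Finset.mem_image.mp hx
    exact ⟨⟨(he _).1.1.trans (hc i).1.le, (hc i).2.le.trans (he _).1.2⟩, hc0 i⟩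
  · rw [Finset.card_image_of_injective _ hmono.injective, Finset.card_univ, Fintype.card_fin]

theorem exists_zero_iterated_deriv {F : ℕ → ℝ → ℝ}
    (hF : ∀ k x, HasDerivAt (F k) (F (k + 1) x) x) {a b : ℝ} (j : ℕ) :
    ∀ (k : ℕ) (s : Finset ℝ), (∀ x ∈ s, x ∈ Set.Icc a b ∧ F k x = 0) → j < s.card →
      ∃ y ∈ Set.Icc a b, F (k + j) y = 0 := by
  induction j with
  | zero =>
    intro k s hs hj
    obtain ⟨x, hx⟩ := Finset.card_pos.mp hj
    exact ⟨x, hs x hx⟩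
  | succ j ih =>
    intro k s hs hj
    obtain ⟨t, ht, htc⟩ := exists_card_zeros_deriv (hF k) hs (j := s.card - 1) (by omega)
    obtain ⟨y, hy, hy0⟩ := ih (k + 1) t ht (by omega)
    exact ⟨y, hy, by rwa [show k + (j + 1) = k + 1 + j by ring]⟩

/-- The `k`-th derivative of `sin (ω x)`. -/
noncomputable def sinJet (ω : ℝ) (k : ℕ) (x : ℝ) : ℝ := ω ^ k * Real.sin (ω * x + k * (π / 2))

theorem hasDerivAt_sinJet (ω : ℝ) (k : ℕ) (x : ℝ) :
    HasDerivAt (sinJet ω k) (sinJet ω (k + 1) x) x := by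
  have h := (((hasDerivAt_id x).const_mul ω).add_const (k * (π / 2))).sin.const_mul (ω ^ k)
  convert! h using 1
  rw [sinJet, Nat.cast_add_one, add_one_mul, ← add_assoc, Real.sin_add_pi_div_two]
  simp only [id]; ring

theorem abs_sinJet_le {ω M : ℝ} (h : |ω| ≤ M) (k : ℕ) (x : ℝ) : |sinJet ω k x| ≤ M ^ k := by
  rw [sinJet, abs_mul, abs_pow]
  calc _ ≤ M ^ k * 1 :=
        mul_le_mul (pow_le_pow_left₀ (abs_nonneg _) h k) (Real.abs_sin_le_one _) (abs_nonneg _)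
          (pow_nonneg ((abs_nonneg _).trans h) k)
    _ = _ := mul_one _

/-- The `k`-th derivative of `profile m ε`. -/
noncomputable def profileJet (m : ℕ) (ε : ℕ → ℝ) (k : ℕ) (x : ℝ) : ℝ :=
  ∑ j ∈ Finset.range (m + 1), ε j * (sinJet (j + 1 / 2) k x - sinJet (j - 1 / 2) k x) -
    sinJet (1 / 2) k x

theorem profileJet_zero (m : ℕ) (ε : ℕ → ℝ) (x : ℝ) : profileJet m ε 0 x = profile m ε x := by
  have h : ∀ j : ℕ, sinJet (j + 1 / 2) 0 x - sinJet (j - 1 / 2) 0 x =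
      2 * Real.sin (x / 2) * Real.cos (j * x) := fun j => by
    have h1 := Real.sin_add (j * x) (x / 2)
    have h2 := Real.sin_sub (j * x) (x / 2)
    simp only [sinJet, pow_zero, one_mul, Nat.cast_zero, zero_mul, add_zero]
    rw [show ((j : ℝ) + 1 / 2) * x = j * x + x / 2 by ring,
      show ((j : ℝ) - 1 / 2) * x = j * x - x / 2 by ring]
    linarith
  simp only [profileJet, h, profile, cosSum, mul_sub, Finset.mul_sum]
  congr 1
  · exact Finset.sum_congr rfl fun _ _ => by ring
  · simp [sinJet]; ring_nf

theorem hasDerivAt_profileJet (m : ℕ) (ε : ℕ → ℝ) (k : ℕ) (x : ℝ) :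
    HasDerivAt (profileJet m ε k) (profileJet m ε (k + 1) x) x := by
  refine HasDerivAt.sub ?_ (hasDerivAt_sinJet _ _ _)
  exact HasDerivAt.fun_sum fun j _ =>
    ((hasDerivAt_sinJet _ _ _).sub (hasDerivAt_sinJet _ _ _)).const_mul _

theorem abs_profileJet_le {m : ℕ} {ε : ℕ → ℝ} (hε : ∀ k, ε k = 0 ∨ ε k = 1) (k : ℕ) (x : ℝ) :
    |profileJet m ε k x| ≤ (2 * m + 3) * (m + 1 / 2) ^ k := by
  have hm : (0 : ℝ) ≤ m := m.cast_nonneg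
  have hterm : ∀ j ∈ Finset.range (m + 1),
      |ε j * (sinJet (j + 1 / 2) k x - sinJet (j - 1 / 2) k x)| ≤ 2 * (m + 1 / 2 : ℝ) ^ k := by
    intro j hj
    have hjm : (j : ℝ) ≤ m := mod_cast Nat.lt_succ_iff.mp (Finset.mem_range.mp hj)
    have hj0 : (0 : ℝ) ≤ j := j.cast_nonneg
    have h1 := abs_sinJet_le (ω := j + 1 / 2) (M := m + 1 / 2)
      (abs_le.mpr ⟨by linarith, by linarith⟩) k x
    have h2 := abs_sinJet_le (ω := j - 1 / 2) (M := m + 1 / 2)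
      (abs_le.mpr ⟨by linarith, by linarith⟩) k x
    have h3 := abs_sub (sinJet (j + 1 / 2) k x) (sinJet (j - 1 / 2) k x)
    have hpow : (0 : ℝ) ≤ (m + 1 / 2) ^ k := by positivity
    rcases hε j with h | h
    · simpa [h] using hpow
    · rw [h, one_mul]; linarith
  have h1 := (Finset.abs_sum_le_sum_abs _ _).trans (Finset.sum_le_sum hterm)
  have h2 := abs_sinJet_le (ω := 1 / 2) (M := m + 1 / 2)
    (abs_le.mpr ⟨by linarith, by linarith⟩) k x
  rw [Finset.sum_const, Finset.card_range, nsmul_eq_mul] at h1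
  push_cast at h1
  rw [profileJet]
  refine (abs_sub _ _).trans ?_
  linarith

theorem card_zeros_le_of_short_interval {n m K : ℕ} {ε : ℕ → ℝ} {a b : ℝ}
    (hab : (n + 1 / 2) * (b - a) ≤ 1 / 2)
    (hK : ∀ x, |profileJet m ε K x| ≤ (n + 1 / 2) ^ K / 4)
    (hK' : ∀ x, |profileJet m ε (K + 1) x| ≤ (n + 1 / 2) ^ (K + 1) / 4)
    {s : Finset ℝ}
    (hs : ∀ x ∈ s, x ∈ Set.Icc a b ∧ Real.sin ((n + 1 / 2) * x) = profile m ε x) :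
    s.card ≤ K + 1 := by
  by_contra! hcard
  have hN : (0 : ℝ) < n + 1 / 2 := by positivity
  set N : ℝ := n + 1 / 2
  have hF : ∀ k x, HasDerivAt (fun x => sinJet N k x - profileJet m ε k x)
      (sinJet N (k + 1) x - profileJet m ε (k + 1) x) x := fun k x =>
    (hasDerivAt_sinJet N k x).sub (hasDerivAt_profileJet m ε k x)
  have hs' : ∀ x ∈ s, x ∈ Set.Icc a b ∧ sinJet N 0 x - profileJet m ε 0 x = 0 := fun x hx =>
    ⟨(hs x hx).1, by rw [profileJet_zero, ← (hs x hx).2]; simp [sinJet]⟩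
  obtain ⟨y, hy, hy0⟩ := exists_zero_iterated_deriv hF K 0 s hs' (by omega)
  obtain ⟨z, hz, hz0⟩ := exists_zero_iterated_deriv hF (K + 1) 0 s hs' (by omega)
  simp only [zero_add] at hy0 hz0
  have hsmall : ∀ (k : ℕ) (w : ℝ), sinJet N k w - profileJet m ε k w = 0 →
      |profileJet m ε k w| ≤ N ^ k / 4 → |Real.sin (N * w + k * (π / 2))| ≤ 1 / 4 := by
    intro k w h0 h1
    rw [← sub_eq_zero.mp h0, sinJet, abs_mul, abs_of_pos (pow_pos hN k)] at h1
    exact le_of_mul_le_mul_left (by linarith) (pow_pos hN k)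
  have h1 := hsmall _ _ hy0 (hK y)
  have h2 := hsmall _ _ hz0 (hK' z)
  rw [Nat.cast_add_one, add_one_mul, ← add_assoc, Real.sin_add_pi_div_two] at h2
  have h3 := Real.abs_sin_sub_sin_le (N * z + K * (π / 2)) (N * y + K * (π / 2))
  rw [add_sub_add_right_eq_sub, ← mul_sub, abs_mul, abs_of_pos hN] at h3
  have h4 : N * |z - y| ≤ 1 / 2 :=
    (mul_le_mul_of_nonneg_left (abs_sub_le_iff.mpr
      ⟨by linarith [hz.2, hy.1], by linarith [hz.1, hy.2]⟩) hN.le).trans hab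
  have h5 : |Real.sin (N * z + K * (π / 2))| ≤ 3 / 4 := by
    have := abs_add_le (Real.sin (N * z + K * (π / 2)) - Real.sin (N * y + K * (π / 2)))
      (Real.sin (N * y + K * (π / 2)))
    rw [sub_add_cancel] at this
    linarith
  have h6 := Real.sin_sq_add_cos_sq (N * z + K * (π / 2))
  rw [← sq_abs (Real.sin _), ← sq_abs (Real.cos _)] at h6
  nlinarith [abs_nonneg (Real.sin (N * z + K * (π / 2))),
    abs_nonneg (Real.cos (N * z + K * (π / 2)))]

theorem ncard_zeros_le {n m K : ℕ} {ε : ℕ → ℝ} (h0 : Dker n 0 - cosSum m ε 0 ≠ 0)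
    (hfin : {x ∈ Set.Icc 0 π | Dker n x - cosSum m ε x = 0}.Finite)
    (hK : ∀ x, |profileJet m ε K x| ≤ (n + 1 / 2) ^ K / 4)
    (hK' : ∀ x, |profileJet m ε (K + 1) x| ≤ (n + 1 / 2) ^ (K + 1) / 4) :
    ({x ∈ Set.Icc 0 π | Dker n x - cosSum m ε x = 0}.ncard : ℝ) ≤
      (K + 1) * (7 * (n + 1) / π * (volume (Eset (cosSum m ε))).toReal + (2 * m + 1)) := by
  classical
  set A := {x ∈ Set.Icc 0 π | Dker n x - cosSum m ε x = 0} with hA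
  set δ := π / (7 * (n + 1) : ℝ) with hδ
  have hM : (0 : ℝ) < 7 * (n + 1) := by positivity
  have hδ0 : 0 < δ := div_pos Real.pi_pos hM
  have hMδ : (7 * (n + 1) : ℝ) * δ = π := mul_div_cancel₀ _ hM.ne'
  have hAmem : ∀ x ∈ A, 0 < x ∧ x ≤ π ∧ Real.sin ((n + 1 / 2) * x) = profile m ε x := by
    intro x hx
    have hx0 : 0 < x := lt_of_le_of_ne hx.1.1 fun h => h0 (h ▸ hx.2)
    exact ⟨hx0, hx.1.2, (sub_eq_zero_iff_profile n m ε hx0 hx.1.2).mp hx.2⟩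
  set φ : ℝ → ℕ := fun x => ⌈x / δ⌉₊ - 1 with hφ
  set cell : ℕ → Set ℝ := fun k => Set.Ioc (k * δ) ((k + 1) * δ) with hcell
  have hφ_iff : ∀ x, 0 < x → ∀ k, φ x = k ↔ x ∈ cell k := by
    intro x hx k
    have hpos : 0 < ⌈x / δ⌉₊ := Nat.ceil_pos.mpr (by positivity)
    have : φ x = k ↔ ⌈x / δ⌉₊ = k + 1 := by simp only [hφ]; omega
    rw [this, Nat.ceil_eq_iff (by simp), hcell]
    simp only [Set.mem_Ioc, ← lt_div_iff₀ hδ0, ← div_le_iff₀ hδ0]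
    simp
  have hcellpos : ∀ k, ∀ x ∈ cell k, 0 < x := fun k x hx => lt_of_le_of_lt (by positivity) hx.1
  have hfiber : ∀ k ∈ hfin.toFinset.image φ,
      (hfin.toFinset.filter fun a => φ a = k).card ≤ K + 1 := by
    intro k _
    refine card_zeros_le_of_short_interval (n := n) (m := m) (ε := ε) (a := k * δ)
      (b := (k + 1) * δ) ?_ hK hK' fun x hx => ?_
    · have : ((k + 1) * δ - k * δ) = δ := by ring
      rw [this]
      nlinarith [Real.pi_lt_d2]
    · simp only [Finset.mem_filter, Set.Finite.mem_toFinset] at hx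
      obtain ⟨hxp, hxpi, hxe⟩ := hAmem x hx.1
      exact ⟨Set.Ioc_subset_Icc_self ((hφ_iff x hxp k).mp hx.2), hxe⟩
  have hcard := Finset.card_le_mul_card_image hfin.toFinset (K + 1) hfiber
  set J := hfin.toFinset.image φ with hJ
  have hJmem : ∀ k ∈ J, (∃ x ∈ A, x ∈ cell k) ∧ ((k : ℝ) + 1) * δ ≤ π := by
    intro k hk
    obtain ⟨x, hx, hxk⟩ := Finset.mem_image.mp hk
    rw [Set.Finite.mem_toFinset] at hx
    obtain ⟨hxp, hxpi, -⟩ := hAmem x hx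
    have hxc := (hφ_iff x hxp k).mp hxk
    refine ⟨⟨x, hx, hxc⟩, ?_⟩
    have h1 : (k : ℝ) < 7 * (n + 1) :=
      lt_of_mul_lt_mul_right (by rw [hMδ]; exact hxc.1.trans_le hxpi) hδ0.le
    have h2 : (k : ℝ) + 1 ≤ 7 * (n + 1) := by
      have : k < 7 * (n + 1) := by exact_mod_cast h1
      exact_mod_cast this
    rw [← hMδ]; gcongr
  set E := Eset (cosSum m ε) with hE
  have hEeq : E = {x ∈ Set.Ioc 0 π | |profile m ε x| < 1} := Eset_cosSum m ε
  have hEfin : volume E ≠ ⊤ :=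
    ((measure_mono (show E ⊆ Set.Ioc 0 π from fun x hx => hx.1)).trans_lt
      measure_Ioc_lt_top).ne
  have hgood : (J.filter fun k => cell k ⊆ E).card * δ ≤ (volume E).toReal := by
    have hdisj : Set.PairwiseDisjoint (↑(J.filter fun k => cell k ⊆ E) : Set ℕ) cell := by
      intro i _ k _ hik
      refine Set.disjoint_left.mpr fun x hi hk => hik ?_
      have hx := hcellpos i x hi
      rw [← (hφ_iff x hx i).mpr hi, (hφ_iff x hx k).mpr hk]
    calc _ = ∑ k ∈ J.filter fun k => cell k ⊆ E, volume.real (cell k) := by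
          rw [Finset.sum_congr rfl fun k _ => show volume.real (cell k) = δ by
            rw [hcell, Real.volume_real_Ioc_of_le (by gcongr; linarith)]; ring]
          simp
      _ = volume.real (⋃ k ∈ J.filter fun k => cell k ⊆ E, cell k) :=
        (measureReal_biUnion_finset hdisj (fun _ _ => measurableSet_Ioc)
          (fun _ _ => measure_Ioc_lt_top.ne)).symm
      _ ≤ volume.real E := by
        refine measureReal_mono (Set.iUnion₂_subset fun k hk => ?_) hEfin
        exact (Finset.mem_filter.mp hk).2
  have hbad : (J.filter fun k => ¬ cell k ⊆ E).card ≤ 2 * m + 1 := by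
    refine (card_le_ncard_of_forall_exists (finite_abs_profile_eq_one m ε).1 φ
      fun k hk => ?_).trans (finite_abs_profile_eq_one m ε).2
    obtain ⟨hkJ, hkE⟩ := Finset.mem_filter.mp hk
    obtain ⟨⟨x, hxA, hxc⟩, hkpi⟩ := hJmem k hkJ
    obtain ⟨y, hyc, hyE⟩ := Set.not_subset.mp hkE
    have hy1 : 1 ≤ |profile m ε y| := by
      by_contra! h
      exact hyE (hEeq ▸ ⟨⟨hcellpos k y hyc, hyc.2.trans hkpi⟩, h⟩)
    have hx1 : |profile m ε x| ≤ 1 := (hAmem x hxA).2.2 ▸ Real.abs_sin_le_one _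
    obtain ⟨z, hzc, hz1⟩ := exists_abs_profile_eq_one isPreconnected_Ioc hxc hyc hx1 hy1
    have hzp := hcellpos k z hzc
    exact ⟨z, ⟨⟨hzp.le, hzc.2.trans hkpi⟩, hz1⟩, (hφ_iff z hzp k).mpr hzc⟩
  have hgood' : ((J.filter fun k => cell k ⊆ E).card : ℝ) ≤
      7 * (n + 1) / π * (volume E).toReal := by
    rw [← le_div_iff₀ hδ0] at hgood
    refine hgood.trans_eq ?_
    rw [hδ]; field_simp
  have hJcard : (J.card : ℝ) ≤ 7 * (n + 1) / π * (volume E).toReal + (2 * m + 1) := by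
    rw [← Finset.card_filter_add_card_filter_not fun k => cell k ⊆ E, Nat.cast_add]
    exact add_le_add hgood' (mod_cast hbad)
  rw [Set.ncard_eq_toFinset_card _ hfin]
  calc (hfin.toFinset.card : ℝ) ≤ (K + 1) * J.card := mod_cast hcard
    _ ≤ _ := by gcongr

theorem exists_jet_bound {α : ℝ} (hα : 0 < α) :
    ∃ K N₀ : ℕ, ∀ (n m : ℕ) (ε : ℕ → ℝ), (∀ k, ε k = 0 ∨ ε k = 1) → 1 ≤ m → N₀ ≤ n →
      (m : ℝ) ≤ (n : ℝ) ^ (1 - α) → ∀ k, K ≤ k → k ≤ K + 1 →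
        ∀ x, |profileJet m ε k x| ≤ (n + 1 / 2 : ℝ) ^ k / 4 := by
  obtain ⟨K, hK⟩ := exists_nat_ge (2 / α)
  rw [div_le_iff₀ hα] at hK
  refine ⟨K, ⌈20 * (3 / 2 : ℝ) ^ (K + 1)⌉₊ + 1, fun n m ε hε hm hn hmn k hk hk' x => ?_⟩
  have hm1 : (1 : ℝ) ≤ m := mod_cast hm
  have hn1 : (1 : ℝ) ≤ n := by exact_mod_cast (show 1 ≤ n by omega)
  have hn20 : 20 * (3 / 2 : ℝ) ^ k ≤ n := by
    calc 20 * (3 / 2 : ℝ) ^ k ≤ 20 * (3 / 2 : ℝ) ^ (K + 1) := by gcongr; norm_num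
      _ ≤ n := Nat.ceil_le.mp (by omega)
  have hkα : 2 ≤ (k : ℝ) * α := hK.trans (by gcongr)
  have hpow : (m : ℝ) ^ (k + 1) * n ≤ n ^ k := by
    calc (m : ℝ) ^ (k + 1) * n ≤ ((n : ℝ) ^ (1 - α)) ^ (k + 1) * n := by gcongr
      _ = (n : ℝ) ^ ((1 - α) * (k + 1) + 1) := by
        rw [Real.rpow_add (by linarith), Real.rpow_one, ← Real.rpow_natCast,
          ← Real.rpow_mul (by linarith)]
        push_cast; rfl
      _ ≤ (n : ℝ) ^ (k : ℝ) := Real.rpow_le_rpow_of_exponent_le hn1 (by nlinarith)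
      _ = _ := Real.rpow_natCast _ _
  refine (abs_profileJet_le hε k x).trans ?_
  have h1 : (2 * m + 3 : ℝ) * (m + 1 / 2) ^ k ≤ 5 * (3 / 2) ^ k * m ^ (k + 1) := by
    calc (2 * m + 3 : ℝ) * (m + 1 / 2) ^ k ≤ (5 * m) * (3 / 2 * m) ^ k := by
          gcongr <;> linarith
      _ = _ := by rw [mul_pow]; ring
  have h2 : (n : ℝ) ^ k ≤ (n + 1 / 2) ^ k := by gcongr; linarith
  have h3 : 20 * (3 / 2 : ℝ) ^ k * m ^ (k + 1) ≤ n * m ^ (k + 1) := by gcongr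
  linarith

theorem volume_Eset_le_pi (g : ℝ → ℝ) : (volume (Eset g)).toReal ≤ π := by
  have h : Eset g ⊆ Set.Ioc 0 π := fun x hx => hx.1
  calc _ ≤ volume.real (Set.Ioc 0 π) := measureReal_mono h measure_Ioc_lt_top.ne
    _ = π := by rw [Real.volume_real_Ioc_of_le Real.pi_pos.le, sub_zero]

theorem one_le_volume_Eset_cosSum_zero {ε : ℕ → ℝ} (hε : ∀ k, ε k = 0 ∨ ε k = 1) :
    1 ≤ (volume (Eset (cosSum 0 ε))).toReal := by
  have hsub : Set.Ioo 0 π ⊆ Eset (cosSum 0 ε) := fun x hx => by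
    rw [Eset_cosSum]
    exact ⟨⟨hx.1, hx.2.le⟩, (abs_profile_zero_le_one hε hx.1 hx.2.le).2 hx.2⟩
  have hfin : volume (Eset (cosSum 0 ε)) ≠ ⊤ :=
    ((measure_mono (show Eset (cosSum 0 ε) ⊆ Set.Ioc 0 π from fun x hx => hx.1)).trans_lt
      measure_Ioc_lt_top).ne
  have h : volume.real (Set.Ioo 0 π) ≤ volume.real (Eset (cosSum 0 ε)) :=
    measureReal_mono hsub hfin
  rw [Real.volume_real_Ioo_of_le Real.pi_pos.le, sub_zero] at h
  exact le_trans (by linarith [Real.pi_gt_three]) h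

theorem zeros_lower_bound {n m : ℕ} {ε : ℕ → ℝ} (hε : ∀ k, ε k = 0 ∨ ε k = 1) :
    (n : ℝ) / (2 * π) * (volume (Eset (cosSum m ε))).toReal - 4 * m ≤
      zeros (fun x => Dker n x - cosSum m ε x) (Set.Icc 0 (2 * π)) := by
  set V := (volume (Eset (cosSum m ε))).toReal with hV
  set Z := zeros (fun x => Dker n x - cosSum m ε x) (Set.Icc 0 (2 * π)) with hZ
  have hpi := Real.pi_pos
  have hZ0 : (0 : ℝ) ≤ Z := Z.cast_nonneg
  have htriv : (n : ℝ) / (2 * π) * V ≤ n / 2 := by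
    calc (n : ℝ) / (2 * π) * V ≤ n / (2 * π) * π := by gcongr; exact volume_Eset_le_pi _
      _ = n / 2 := by field_simp
  rcases le_or_gt n m with hnm | hmn
  · have : (n : ℝ) ≤ m := mod_cast hnm
    have hn : (0 : ℝ) ≤ n := n.cast_nonneg
    linarith
  have hne : ∃ x, Dker n x - cosSum m ε x ≠ 0 := ⟨0, (sub_apply_zero_pos hε hmn).ne'⟩
  have hfin := (finite_zeros_sub hne hmn.le).1
  have hAZ := (zeros_le_two_mul hne hmn.le).1
  rcases Nat.eq_zero_or_pos m with rfl | hm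
  · have hδ0 : 0 < π / (n + 1 / 2 : ℝ) := by positivity
    have hNδ : (n + 1 / 2 : ℝ) * (π / (n + 1 / 2 : ℝ)) = π := mul_div_cancel₀ _ (by positivity)
    have hcard : n ≤ {x ∈ Set.Icc 0 π | Dker n x - cosSum 0 ε x = 0}.ncard := by
      refine (Finset.card_range n).symm.trans_le <|
        card_le_ncard_zeros hfin fun k hk => ?_
      have hk := Finset.mem_range.mp hk
      have hkn : (k : ℝ) + 1 ≤ n := mod_cast hk
      refine ⟨hk, ?_, ?_⟩
      · have hlt : ((k : ℝ) + 1 / 2) * (π / (n + 1 / 2)) < π := by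
          conv_rhs => rw [← hNδ]
          gcongr
        exact (abs_profile_zero_le_one hε (by positivity) hlt.le).2 hlt
      · refine (abs_profile_zero_le_one hε (by positivity) ?_).1
        conv_rhs => rw [← hNδ]
        gcongr
    have : (n : ℝ) ≤ Z := mod_cast hcard.trans hAZ
    simp only [Nat.cast_zero, mul_zero, sub_zero]
    linarith
  · have hvol := volume_Eset_le hfin
    set A := {x ∈ Set.Icc 0 π | Dker n x - cosSum m ε x = 0}.ncard
    have hm1 : (1 : ℝ) ≤ m := mod_cast hm
    have hAZ' : (A : ℝ) ≤ Z := mod_cast hAZ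
    have : (n : ℝ) / (2 * π) * V ≤ (A + (2 * m + 1) + 1 / 2) / 2 := by
      calc (n : ℝ) / (2 * π) * V ≤
          (n + 1 / 2) / (2 * π) * (π / (n + 1 / 2) * (A + (2 * m + 1) + 1 / 2)) := by
            gcongr; linarith
        _ = _ := by field_simp
    linarith

theorem zeros_upper_bound {α : ℝ} (hα : α ∈ Set.Ioo (0 : ℝ) 1) {n m K N₀ : ℕ} {ε : ℕ → ℝ}
    (hε : ∀ k, ε k = 0 ∨ ε k = 1) (hmn : (m : ℝ) ≤ (n : ℝ) ^ (1 - α))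
    (hjet : 1 ≤ m → N₀ ≤ n → ∀ k, K ≤ k → k ≤ K + 1 →
      ∀ x, |profileJet m ε k x| ≤ (n + 1 / 2 : ℝ) ^ k / 4) :
    (zeros (fun x => Dker n x - cosSum m ε x) (Set.Icc 0 (2 * π)) : ℝ) ≤
      (28 * (K + 1) + 2 * N₀ + 2) * (n * (volume (Eset (cosSum m ε))).toReal + m) := by
  set V := (volume (Eset (cosSum m ε))).toReal with hV
  have hV0 : 0 ≤ V := ENNReal.toReal_nonneg
  have hnV : 0 ≤ n * V := by positivity
  by_cases hne : ∃ x, Dker n x - cosSum m ε x ≠ 0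
  swap
  · push Not at hne
    have : zeros (fun x => Dker n x - cosSum m ε x) (Set.Icc 0 (2 * π)) = 0 := by
      simp only [zeros, hne, and_true, Set.ofPred_mem_eq]
      exact (Set.Icc_infinite (by linarith [Real.pi_pos])).ncard
    rw [this, Nat.cast_zero]
    positivity
  have hle : m ≤ n := by
    rcases Nat.eq_zero_or_pos n with rfl | hn
    · rw [Nat.cast_zero, Real.zero_rpow (by linarith [hα.2])] at hmn
      exact_mod_cast hmn
    · have hn1 : (1 : ℝ) ≤ n := mod_cast hn
      exact_mod_cast hmn.trans (Real.rpow_le_self_of_one_le hn1 (by linarith [hα.1]))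
  obtain ⟨hfin, hAn⟩ := finite_zeros_sub hne hle
  have hZA := (zeros_le_two_mul hne hle).2
  set A := {x ∈ Set.Icc 0 π | Dker n x - cosSum m ε x = 0}.ncard
  set Z := zeros (fun x => Dker n x - cosSum m ε x) (Set.Icc 0 (2 * π))
  have hZA' : (Z : ℝ) ≤ 2 * A := mod_cast hZA
  have hAn' : (A : ℝ) ≤ n := mod_cast hAn
  have hN0 : (0 : ℝ) ≤ N₀ := N₀.cast_nonneg
  have hK0 : (0 : ℝ) ≤ K := K.cast_nonneg
  rcases Nat.eq_zero_or_pos m with rfl | hm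
  · have h1 : (n : ℝ) ≤ n * V := le_mul_of_one_le_right n.cast_nonneg
      (one_le_volume_Eset_cosSum_zero hε)
    simp only [Nat.cast_zero, add_zero]
    nlinarith [mul_nonneg hN0 hnV, mul_nonneg hK0 hnV]
  have hm1 : (1 : ℝ) ≤ m := mod_cast hm
  have hN0m : (0 : ℝ) ≤ N₀ * (m - 1) := mul_nonneg hN0 (by linarith)
  have hKm : (0 : ℝ) ≤ K * (m - 1) := mul_nonneg hK0 (by linarith)
  rcases lt_or_ge n N₀ with hn | hn
  · have : (n : ℝ) ≤ N₀ := mod_cast hn.le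
    nlinarith [mul_nonneg hN0 hnV, mul_nonneg hK0 hnV]
  rcases eq_or_lt_of_le hle with heq | hlt
  · have : (n : ℝ) = m := mod_cast heq.symm
    nlinarith [mul_nonneg hN0 hnV, mul_nonneg hK0 hnV]
  have hbound := ncard_zeros_le (sub_apply_zero_pos hε hlt).ne' hfin
    (hjet hm hn K le_rfl (by omega)) (hjet hm hn (K + 1) (by omega) le_rfl)
  have hn1 : (1 : ℝ) ≤ n := mod_cast (show 1 ≤ n from le_trans hm hle)
  have hcoef : 7 * ((n : ℝ) + 1) / π * V ≤ 14 * (n * V) := by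
    rw [← mul_assoc]
    gcongr
    rw [div_le_iff₀ Real.pi_pos]
    nlinarith [Real.pi_gt_three]
  have hfinal : (A : ℝ) ≤ (K + 1) * (14 * (n * V) + 3 * m) := by
    refine hbound.trans ?_
    gcongr
    linarith
  nlinarith [mul_nonneg hN0 hnV, mul_nonneg hK0 hnV]

/-- There is an absolute constant `c > 0` and, for each `α ∈ (0,1)`, a constant `C_α > 0`
such that: if `g` is a `{0,1}`-cosine polynomial of degree `m ≤ n^{1-α}` and `f = D_n - g`,
then `(n/2π)|E(g)| - c m ≤ Z(f) ≤ C_α (n |E(g)| + m) + c n^{0.6}`. -/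
theorem stmt9 :
    ∃ c : ℝ, 0 < c ∧ ∀ α : ℝ, α ∈ Set.Ioo (0 : ℝ) 1 → ∃ C : ℝ, 0 < C ∧
      ∀ (n m : ℕ) (ε : ℕ → ℝ), (∀ k, ε k = 0 ∨ ε k = 1) →
        (m : ℝ) ≤ (n : ℝ) ^ ((1 : ℝ) - α) →
        ∀ g f : ℝ → ℝ,
          g = (fun x => ∑ k ∈ Finset.range (m + 1), ε k * Real.cos (k * x)) →
          f = (fun x => Dker n x - g x) →
          (n : ℝ) / (2 * π) * (volume (Eset g)).toReal - c * m ≤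
              (zeros f (Set.Icc 0 (2 * π)) : ℝ) ∧
            (zeros f (Set.Icc 0 (2 * π)) : ℝ) ≤
              C * ((n : ℝ) * (volume (Eset g)).toReal + m) + c * (n : ℝ) ^ (0.6 : ℝ) := by
  refine ⟨4, by norm_num, fun α hα => ?_⟩
  obtain ⟨K, N₀, hjet⟩ := exists_jet_bound hα.1
  refine ⟨28 * (K + 1) + 2 * N₀ + 2, by positivity, ?_⟩
  rintro n m ε hε hmn g f rfl rfl
  refine ⟨zeros_lower_bound hε, ?_⟩
  refine (zeros_upper_bound hα hε hmn fun hm hn => hjet n m ε hε hm hn hmn).trans ?_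
  exact le_add_of_nonneg_right (by positivity)
end

section
/- There exist constants c, C > 0 and a natural number m_0 such that for all m ≥ m_0 the following holds: if g(x) = ∑_{k=0}^{m} ε_k cos(kx), where ε_0, …, ε_m are independent random variables taking values 0 and 1 each with probability 1/2, then c·(log m)/√m ≤ E |E(g)| ≤ C·(log m)/√m, where |E(g)| denotes the Lebesgue measure of the set E(g) = {x ∈ (0, π] : |g(x) − 1/2| < s(x)}. -/
open Real MeasureTheory

/-- The random polynomial `g ~ G_m` determined by the Bernoulli outcomes
`e : Fin (m+1) → Bool`:  `g(x) = ∑_{k=0}^m ε_k cos(kx)`. -/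
noncomputable def gB (m : ℕ) (e : Fin (m + 1) → Bool) : ℝ → ℝ :=
  fun x => ∑ k : Fin (m + 1), (if e k then (1 : ℝ) else 0) * Real.cos ((k : ℕ) * x)

theorem Nat.three_mul_add_one_mul_sq_centralBinom_le (n : ℕ) :
    (3 * n + 1) * n.centralBinom ^ 2 ≤ 16 ^ n := by
  induction n with
  | zero => simp
  | succ n ih =>
    have h := Nat.succ_mul_centralBinom_succ n
    have hpos : 0 < (n + 1) ^ 2 * (3 * n + 1) := by positivity
    refine Nat.le_of_mul_le_mul_left ?_ hpos
    calc (n + 1) ^ 2 * (3 * n + 1) * ((3 * (n + 1) + 1) * (n + 1).centralBinom ^ 2)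
        = (3 * n + 4) * (3 * n + 1) * ((n + 1) * (n + 1).centralBinom) ^ 2 := by ring
      _ = (4 * (3 * n + 4) * (2 * n + 1) ^ 2) * ((3 * n + 1) * n.centralBinom ^ 2) := by
        rw [h]; ring
      _ ≤ (16 * (n + 1) ^ 2 * (3 * n + 1)) * 16 ^ n :=
        Nat.mul_le_mul (by nlinarith) ih
      _ = (n + 1) ^ 2 * (3 * n + 1) * 16 ^ (n + 1) := by ring

theorem Nat.mul_sq_choose_half_le (n : ℕ) : n * (n.choose (n / 2)) ^ 2 ≤ 4 ^ n := by
  obtain ⟨k, rfl | rfl⟩ := n.even_or_odd'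
  · have h := Nat.three_mul_add_one_mul_sq_centralBinom_le k
    rw [Nat.mul_div_cancel_left k two_pos, ← Nat.centralBinom_eq_two_mul_choose, pow_mul]
    norm_num
    nlinarith [sq_nonneg k.centralBinom]
  · have h := Nat.three_mul_add_one_mul_sq_centralBinom_le (k + 1)
    have h2 : (k + 1).centralBinom = 2 * (2 * k + 1).choose k := by
      rw [Nat.centralBinom_eq_two_mul_choose, show 2 * (k + 1) = (2 * k + 1) + 1 by ring,
        Nat.choose_succ_succ, ← Nat.choose_symm_half]
      ring
    rw [h2, pow_succ 16] at h
    rw [show (2 * k + 1) / 2 = k by omega, pow_succ 4, pow_mul 4]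
    norm_num at h ⊢
    nlinarith [sq_nonneg ((2 * k + 1).choose k)]

theorem choose_half_le_two_pow_div_sqrt {n : ℕ} (hn : 0 < n) :
    (n.choose (n / 2) : ℝ) ≤ 2 ^ n / √n := by
  have hn' : (0 : ℝ) < n := by exact_mod_cast hn
  rw [le_div_iff₀ (by positivity)]
  refine abs_le_of_sq_le_sq' ?_ (by positivity) |>.2
  rw [mul_pow, Real.sq_sqrt hn'.le, ← pow_mul, mul_comm n 2, pow_mul]
  have := Nat.mul_sq_choose_half_le n
  norm_num
  rw [mul_comm]
  exact_mod_cast this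

/-- Erdős' form of the Littlewood-Offord inequality, for subset sums of numbers that are
at least `1/2`. -/
theorem card_subset_sum_mem_Ico_le {α : Type*} [Fintype α] [DecidableEq α] (a : α → ℝ)
    (ha : ∀ i, 1 / 2 ≤ a i) (u : ℝ) :
    ({S : Finset α | u ≤ ∑ i ∈ S, a i ∧ ∑ i ∈ S, a i < u + 1 / 2} : Finset (Finset α)).card ≤
      (Fintype.card α).choose (Fintype.card α / 2) := by
  refine IsAntichain.sperner ?_
  intro S hS T hT hne hsub
  simp only [Finset.coe_filter, Finset.mem_univ, true_and, Set.mem_ofPred_eq] at hS hT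
  obtain ⟨i, hiT, hiS⟩ := Finset.exists_of_ssubset (Finset.ssubset_iff_subset_ne.2 ⟨hsub, hne⟩)
  have h1 : ∑ j ∈ insert i S, a j ≤ ∑ j ∈ T, a j :=
    Finset.sum_le_sum_of_subset_of_nonneg (Finset.insert_subset hiT hsub)
      fun j _ _ => by linarith [ha j]
  rw [Finset.sum_insert hiS] at h1
  linarith [ha i, hS.1, hT.2]

theorem card_bool_sum_mem_Ico_le {α : Type*} [Fintype α] [DecidableEq α] (a : α → ℝ)
    (ha : ∀ i, 1 / 2 ≤ |a i|) (u : ℝ) :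
    ({e : α → Bool | u ≤ ∑ i, (if e i then (1 : ℝ) else 0) * a i ∧
      ∑ i, (if e i then (1 : ℝ) else 0) * a i < u + 1 / 2} : Finset (α → Bool)).card ≤
      (Fintype.card α).choose (Fintype.card α / 2) := by
  set c : ℝ := ∑ i, min (a i) 0 with hc
  refine le_trans ?_ (card_subset_sum_mem_Ico_le (fun i => |a i|) ha (u - c))
  have key (e : α → Bool) : ∑ i ∈ ({i | e i = decide (0 < a i)} : Finset α), |a i| =
      ∑ i, (if e i then (1 : ℝ) else 0) * a i - c := by
    rw [Finset.sum_filter, hc, ← Finset.sum_sub_distrib]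
    refine Finset.sum_congr rfl fun i _ => ?_
    by_cases h : 0 < a i
    · cases he : e i <;> simp [h, h.le, abs_of_pos]
    · have h' := not_lt.1 h
      cases he : e i <;> simp [h, h', abs_of_nonpos]
  refine Finset.card_le_card_of_injOn 
    (fun e => ({i | e i = decide (0 < a i)} : Finset α)) ?_ ?_
  · intro e he
    simp only [Finset.coe_filter, Finset.mem_univ, true_and, Set.mem_ofPred_eq] at he ⊢
    rw [key]
    constructor <;> linarith [he.1, he.2]
  · intro e _ e' _ h
    funext i
    have := Finset.ext_iff.1 h i
    simp only [Finset.mem_filter, Finset.mem_univ, true_and] at this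
    revert this
    cases e i <;> cases e' i <;> cases decide (0 < a i) <;> simp

theorem card_bool_sum_abs_lt_le {α : Type*} [Fintype α] [DecidableEq α] (a : α → ℝ)
    (ha : ∀ i, 1 / 2 ≤ |a i|) (u : ℝ) {s : ℝ} (hs : 1 / 2 ≤ s) :
    (({e : α → Bool | |∑ i, (if e i then (1 : ℝ) else 0) * a i - u| < s} :
      Finset (α → Bool)).card : ℝ) ≤
      6 * s * (Fintype.card α).choose (Fintype.card α / 2) := by
  set K := (Fintype.card α).choose (Fintype.card α / 2)
  set X : (α → Bool) → ℝ := fun e => ∑ i, (if e i then (1 : ℝ) else 0) * a i with hX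
  have hnat : ({e : α → Bool | |X e - u| < s} : Finset (α → Bool)).card ≤
      K * (Finset.range ⌈4 * s⌉₊).card := by
    refine Finset.card_le_mul_card_image_of_maps_to (f := fun e => ⌊2 * (X e - (u - s))⌋₊) ?_ K ?_
    · intro e he
      simp only [Finset.mem_filter, Finset.mem_univ, true_and, abs_lt] at he
      rw [Finset.mem_range, Nat.floor_lt (by linarith)]
      exact lt_of_lt_of_le (by linarith) (Nat.le_ceil _)
    · intro j _
      refine le_trans (Finset.card_le_card ?_) (card_bool_sum_mem_Ico_le a ha (u - s + j / 2))
      intro e he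
      simp only [Finset.mem_filter, Finset.mem_univ, true_and, abs_lt] at he ⊢
      obtain ⟨⟨h1, h2⟩, h3⟩ := he
      rw [Nat.floor_eq_iff (by linarith)] at h3
      simp only [hX] at h3
      constructor <;> linarith [h3.1, h3.2]
  have hceil := Nat.ceil_lt_add_one (a := 4 * s) (by linarith)
  calc (({e : α → Bool | |X e - u| < s} : Finset (α → Bool)).card : ℝ)
      ≤ K * ⌈4 * s⌉₊ := by
        rw [Finset.card_range] at hnat
        exact_mod_cast hnat
    _ ≤ K * (6 * s) := by gcongr; linarith
    _ = 6 * s * K := by ring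

theorem card_sum_abs_lt_le {ι : Type*} [Fintype ι] [DecidableEq ι] (a : ι → ℝ) (u : ℝ) {s : ℝ}
    (hs : 1 / 2 ≤ s) {n : ℕ} (hn : 0 < n)
    (hcard : n ≤ ({i | 1 / 2 ≤ |a i|} : Finset ι).card) :
    (({e : ι → Bool | |∑ i, (if e i then (1 : ℝ) else 0) * a i - u| < s} :
      Finset (ι → Bool)).card : ℝ) ≤ 6 * s * 2 ^ Fintype.card ι / √n := by
  set p : ι → Prop := fun i => 1 / 2 ≤ |a i| with hp
  set A := {i // p i}
  set B := {i // ¬ p i}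
  have hA : n ≤ Fintype.card A := by rwa [Fintype.card_subtype]
  have hsplit (e : ι → Bool) : ∑ i, (if e i then (1 : ℝ) else 0) * a i =
      ∑ i : A, (if e i then (1 : ℝ) else 0) * a i + ∑ i : B, (if e i then (1 : ℝ) else 0) * a i :=
    (Fintype.sum_subtype_add_sum_subtype p _).symm
  have hAB : Fintype.card ι = Fintype.card A + Fintype.card B := by
    rw [← Fintype.card_sum, Fintype.card_congr (Equiv.sumCompl p)]
  have hnat : ({e : ι → Bool | |∑ i, (if e i then (1 : ℝ) else 0) * a i - u| < s} :
      Finset (ι → Bool)).card = ∑ e' : B → Bool, ({e : A → Bool |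
        |∑ i, (if e i then (1 : ℝ) else 0) * a i -
          (u - ∑ i, (if e' i then (1 : ℝ) else 0) * a i)| < s} : Finset (A → Bool)).card := by
    simp only [Finset.card_filter]
    rw [← Equiv.sum_comp (Equiv.piEquivPiSubtypeProd p (fun _ => Bool)).symm,
      Fintype.sum_prod_type_right]
    refine Finset.sum_congr rfl fun e' _ => Finset.sum_congr rfl fun e _ => ?_
    rw [hsplit]
    have h1 : ∑ i : A, (if (Equiv.piEquivPiSubtypeProd p (fun _ => Bool)).symm (e, e') i
        then (1 : ℝ) else 0) * a i = ∑ i : A, (if e i then (1 : ℝ) else 0) * a i :=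
      Finset.sum_congr rfl fun i _ => by simp [Equiv.piEquivPiSubtypeProd, i.2]
    have h2 : ∑ i : B, (if (Equiv.piEquivPiSubtypeProd p (fun _ => Bool)).symm (e, e') i
        then (1 : ℝ) else 0) * a i = ∑ i : B, (if e' i then (1 : ℝ) else 0) * a i :=
      Finset.sum_congr rfl fun i _ => by simp [Equiv.piEquivPiSubtypeProd, i.2]
    rw [h1, h2, add_sub_assoc, sub_sub_eq_add_sub, add_sub_assoc]
  rw [hnat, Nat.cast_sum]
  have hn' : (0 : ℝ) < n := by exact_mod_cast hn
  calc _ ≤ ∑ _e' : B → Bool, 6 * s * (2 ^ Fintype.card A / √n) := by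
        refine Finset.sum_le_sum fun e' _ => ?_
        refine (card_bool_sum_abs_lt_le (fun i : A => a i) (fun i => i.2) _ hs).trans ?_
        gcongr
        refine (choose_half_le_two_pow_div_sqrt (hn.trans_le hA)).trans ?_
        gcongr
    _ = 6 * s * 2 ^ Fintype.card ι / √n := by
        rw [Finset.sum_const, Finset.card_univ, Fintype.card_fun, Fintype.card_bool, hAB, pow_add,
          nsmul_eq_mul]
        push_cast
        ring

theorem half_le_abs_cos_or_half_le_abs_cos_two_mul (y : ℝ) :
    1 / 2 ≤ |cos y| ∨ 1 / 2 ≤ |cos (2 * y)| := by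
  by_contra! h
  have h1 := abs_lt.1 h.1
  have h2 := abs_lt.1 h.2
  rw [cos_two_mul] at h2
  nlinarith

theorem le_card_half_le_abs_cos (m : ℕ) (x : ℝ) :
    (m + 2) / 4 ≤ ({k : Fin (m + 1) | 1 / 2 ≤ |cos ((k : ℕ) * x)|} : Finset (Fin (m + 1))).card := by
  let φ : Fin ((m + 2) / 4) → Fin (m + 1) := fun j =>
    if 1 / 2 ≤ |cos ((2 * j + 1 : ℕ) * x)| then ⟨2 * j + 1, by omega⟩ else ⟨4 * j + 2, by omega⟩
  have hφ (j) : 1 / 2 ≤ |cos ((φ j : ℕ) * x)| := by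
    simp only [φ]
    split_ifs with h
    · exact h
    · have := (half_le_abs_cos_or_half_le_abs_cos_two_mul ((2 * j + 1 : ℕ) * x)).resolve_left h
      convert this using 3
      push_cast
      ring
  have hinj : Function.Injective φ := by
    intro i j h
    simp only [φ] at h
    split_ifs at h <;> simp only [Fin.mk.injEq] at h <;> omega
  calc (m + 2) / 4 = (Finset.univ.image φ).card := by
        rw [Finset.card_image_of_injective _ hinj, Finset.card_univ, Fintype.card_fin]
    _ ≤ _ := Finset.card_le_card fun k hk => by
        obtain ⟨j, -, rfl⟩ := Finset.mem_image.1 hk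
        simpa using hφ j

/-- The sign `±1` encoded by a Boolean. -/
def boolSign (b : Bool) : ℝ := if b then 1 else -1

@[simp] theorem boolSign_true : boolSign true = 1 := if_pos rfl

@[simp] theorem boolSign_false : boolSign false = -1 := if_neg Bool.false_ne_true

@[simp] theorem boolSign_not (b : Bool) : boolSign (!b) = -boolSign b := by cases b <;> simp

theorem sum_sq_boolSign_sum {n : ℕ} (a : Fin n → ℝ) :
    ∑ e : Fin n → Bool, (∑ i, boolSign (e i) * a i) ^ 2 = 2 ^ n * ∑ i, a i ^ 2 := by
  induction n with
  | zero => simp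
  | succ n ih =>
    rw [← Equiv.sum_comp (Fin.consEquiv fun _ => Bool), Fintype.sum_prod_type]
    simp only [Fin.consEquiv, Equiv.coe_fn_mk, Fin.sum_univ_succ, Fin.cons_zero, Fin.cons_succ,
      Fintype.sum_bool, boolSign_true, boolSign_false]
    rw [← Finset.sum_add_distrib]
    have h (e : Fin n → Bool) : (1 * a 0 + ∑ i, boolSign (e i) * a i.succ) ^ 2 +
        (-1 * a 0 + ∑ i, boolSign (e i) * a i.succ) ^ 2 =
        2 * a 0 ^ 2 + 2 * (∑ i, boolSign (e i) * a i.succ) ^ 2 := by ring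
    simp only [h]
    rw [Finset.sum_add_distrib, Finset.sum_const, ← Finset.mul_sum, ih fun i => a i.succ,
      Finset.card_univ, Fintype.card_fun, Fintype.card_bool, Fintype.card_fin, nsmul_eq_mul]
    push_cast
    ring

/-- Chebyshev's inequality for Rademacher sums. -/
theorem card_lt_abs_boolSign_sum_le {n : ℕ} (a : Fin n → ℝ) {t : ℝ} (ht : 0 ≤ t) :
    t ^ 2 * ({e | t < |∑ i, boolSign (e i) * a i|} : Finset (Fin n → Bool)).card ≤
      2 ^ n * ∑ i, a i ^ 2 := by
  rw [← sum_sq_boolSign_sum, mul_comm, ← nsmul_eq_mul, ← Finset.sum_const]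
  refine (Finset.sum_le_sum fun e he => ?_).trans
    (Finset.sum_le_univ_sum_of_nonneg fun e => sq_nonneg _)
  rw [← sq_abs (∑ i, _)]
  exact pow_le_pow_left₀ ht (Finset.mem_filter.1 he).2.le 2

/-- A lower bound for the number of colliding pairs of a colouring. -/
theorem sq_card_le_mul_card_pairs {α : Type*} [DecidableEq α] (G : Finset α) (f : α → ℕ) (M : ℕ)
    (hf : ∀ e ∈ G, f e < M) :
    G.card ^ 2 ≤ M * ({p ∈ G ×ˢ G | f p.1 = f p.2} : Finset (α × α)).card := by
  have hG : G.card = ∑ j ∈ Finset.range M, ({e ∈ G | f e = j} : Finset α).card :=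
    Finset.card_eq_sum_card_fiberwise fun e he => Finset.mem_coe.2 (Finset.mem_range.2 (hf e he))
  have hP : ({p ∈ G ×ˢ G | f p.1 = f p.2} : Finset (α × α)).card =
      ∑ j ∈ Finset.range M, ({e ∈ G | f e = j} : Finset α).card ^ 2 := by
    rw [Finset.card_eq_sum_card_fiberwise (f := fun p => f p.1) (t := Finset.range M)]
    · refine Finset.sum_congr rfl fun j _ => ?_
      rw [sq, ← Finset.card_product]
      congr 1
      ext p
      simp only [Finset.mem_filter, Finset.mem_product]
      constructor
      · rintro ⟨⟨⟨h1, h2⟩, h3⟩, h4⟩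
        exact ⟨⟨h1, h4⟩, h2, h3 ▸ h4⟩
      · rintro ⟨⟨h1, h2⟩, h3, h4⟩
        exact ⟨⟨⟨h1, h3⟩, h2.trans h4.symm⟩, h2⟩
    · intro p hp
      have hp' := (Finset.mem_product.1 (Finset.mem_filter.1 (Finset.mem_coe.1 hp)).1).1
      exact Finset.mem_coe.2 (Finset.mem_range.2 (hf _ hp'))
  rw [hP]
  nth_rewrite 1 [hG]
  simpa using sq_sum_le_card_mul_sum_sq (s := Finset.range M)
    (f := fun j => ({e ∈ G | f e = j} : Finset α).card)

/-- If the coefficients `a` and `b` are close to each other, then two independent Rademacher sums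
with these coefficients are close to each other with the expected frequency. -/
theorem card_pairs_abs_boolSign_sum_sub_le {n : ℕ} (a b : Fin n → ℝ) {x τ q : ℝ}
    (ha : ∀ i, |a i| ≤ 1) (hab : ∀ i, |a i - b i| ≤ x) (hτ : 0 < τ) (hτq : τ ≤ q)
    (hn : (n : ℝ) ≤ q ^ 2) (hx : 64 * (n * x ^ 2) ≤ τ ^ 2) :
    4 ^ n * τ ≤ 72 * q * (({p | |∑ i, boolSign (p.1 i) * a i - ∑ i, boolSign (p.2 i) * b i| ≤ τ / 2} :
      Finset ((Fin n → Bool) × (Fin n → Bool))).card : ℝ) := by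
  have hq : 0 < q := hτ.trans_le hτq
  set F : (Fin n → Bool) → ℝ := fun e => ∑ i, boolSign (e i) * a i with hF
  set H : (Fin n → Bool) → ℝ := fun e => ∑ i, boolSign (e i) * b i with hH
  set G : Finset (Fin n → Bool) := {e | |F e| ≤ 2 * q ∧ |F e - H e| ≤ τ / 4} with hG
  have hB1 : ((({e | 2 * q < |F e|} : Finset (Fin n → Bool)).card : ℝ)) ≤ 2 ^ n / 4 := by
    have h := card_lt_abs_boolSign_sum_le a (t := 2 * q) (by positivity)
    have h2 : ∑ i, a i ^ 2 ≤ q ^ 2 := by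
      refine le_trans ?_ hn
      calc ∑ i, a i ^ 2 ≤ ∑ _i : Fin n, (1 : ℝ) :=
            Finset.sum_le_sum fun i _ => (sq_le_one_iff_abs_le_one _).2 (ha i)
        _ = n := by simp
    have h3 : (q ^ 2) * (4 * (({e | 2 * q < |F e|} : Finset (Fin n → Bool)).card : ℝ)) ≤
        q ^ 2 * 2 ^ n := by
      have := mul_le_mul_of_nonneg_left h2 (show (0 : ℝ) ≤ 2 ^ n by positivity)
      linarith
    linarith [le_of_mul_le_mul_left h3 (by positivity)]
  have hB2 : ((({e | τ / 4 < |F e - H e|} : Finset (Fin n → Bool)).card : ℝ)) ≤ 2 ^ n / 4 := by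
    have h := card_lt_abs_boolSign_sum_le (fun i => a i - b i) (t := τ / 4) (by positivity)
    simp only [mul_sub, Finset.sum_sub_distrib] at h
    have h2 : ∑ i, (a i - b i) ^ 2 ≤ n * x ^ 2 := by
      calc ∑ i, (a i - b i) ^ 2 ≤ ∑ _i : Fin n, x ^ 2 :=
            Finset.sum_le_sum fun i _ => sq_le_sq' (abs_le.1 (hab i)).1 (abs_le.1 (hab i)).2
        _ = n * x ^ 2 := by simp
    have h3 : (τ ^ 2) * (4 * (({e | τ / 4 < |F e - H e|} : Finset (Fin n → Bool)).card : ℝ)) ≤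
        τ ^ 2 * 2 ^ n := by
      have := mul_le_mul_of_nonneg_left (h2.trans (by linarith : n * x ^ 2 ≤ τ ^ 2 / 64))
        (show (0 : ℝ) ≤ 2 ^ n by positivity)
      linarith
    linarith [le_of_mul_le_mul_left h3 (by positivity)]
  have hGcard : (2 : ℝ) ^ n / 2 ≤ G.card := by
    have hcover : (Finset.univ : Finset (Fin n → Bool)) ⊆
        G ∪ (({e | 2 * q < |F e|} : Finset (Fin n → Bool)) ∪
          ({e | τ / 4 < |F e - H e|} : Finset (Fin n → Bool))) := by
      intro e _
      simp only [hG, Finset.mem_union, Finset.mem_filter, Finset.mem_univ, true_and]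
      by_contra! h
      exact absurd (h.1 h.2.1) (not_lt.2 h.2.2)
    have h1 := (Finset.card_le_card hcover).trans
      ((Finset.card_union_le _ _).trans (Nat.add_le_add_left (Finset.card_union_le _ _) _))
    rw [Finset.card_univ, Fintype.card_fun, Fintype.card_bool, Fintype.card_fin] at h1
    have h2 : (2 : ℝ) ^ n ≤ G.card + ((({e | 2 * q < |F e|} : Finset (Fin n → Bool)).card : ℝ) +
        (({e | τ / 4 < |F e - H e|} : Finset (Fin n → Bool)).card : ℝ)) := by exact_mod_cast h1
    linarith
  set f : (Fin n → Bool) → ℕ := fun e => ⌊(F e + 2 * q) / (τ / 4)⌋₊ with hf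
  set M : ℕ := ⌊4 * q / (τ / 4)⌋₊ + 1 with hM
  have hfM : ∀ e ∈ G, f e < M := by
    intro e he
    refine Nat.lt_succ_of_le (Nat.floor_le_floor ?_)
    have := abs_le.1 (Finset.mem_filter.1 he).2.1
    gcongr
    linarith
  have hMle : (M : ℝ) * τ ≤ 18 * q := by
    have h := Nat.floor_le (a := 4 * q / (τ / 4)) (by positivity)
    rw [hM]
    push_cast
    rw [le_div_iff₀ (by positivity)] at h
    linarith
  have hpairs := sq_card_le_mul_card_pairs G f M hfM
  set P : Finset ((Fin n → Bool) × (Fin n → Bool)) := {p | |F p.1 - H p.2| ≤ τ / 2} with hP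
  have hsub : ({p ∈ G ×ˢ G | f p.1 = f p.2} : Finset _) ⊆ P := by
    intro p hp
    simp only [hG, Finset.mem_filter, Finset.mem_product, Finset.mem_univ, true_and] at hp
    obtain ⟨⟨⟨h1, -⟩, h2, h3⟩, h4⟩ := hp
    simp only [hP, Finset.mem_filter, Finset.mem_univ, true_and]
    have e1 : 0 ≤ (F p.1 + 2 * q) / (τ / 4) :=
      div_nonneg (by linarith [(abs_le.1 h1).1]) (by positivity)
    have e2 : 0 ≤ (F p.2 + 2 * q) / (τ / 4) :=
      div_nonneg (by linarith [(abs_le.1 h2).1]) (by positivity)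
    have l1 := Nat.floor_le e1
    have u1 := Nat.lt_floor_add_one ((F p.1 + 2 * q) / (τ / 4))
    have l2 := Nat.floor_le e2
    have u2 := Nat.lt_floor_add_one ((F p.2 + 2 * q) / (τ / 4))
    simp only [hf] at h4
    rw [h4] at l1 u1
    rw [le_div_iff₀ (by positivity)] at l1 l2
    rw [div_lt_iff₀ (by positivity)] at u1 u2
    have h3' := abs_le.1 h3
    rw [abs_le]
    constructor <;> linarith
  have hfinal : ((G.card : ℝ)) ^ 2 ≤ M * P.card := by
    exact_mod_cast hpairs.trans (Nat.mul_le_mul_left M (Finset.card_le_card hsub))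
  have h4 : (4 : ℝ) ^ n = 2 ^ n * 2 ^ n := by rw [← mul_pow]; norm_num
  have h5 : (2 : ℝ) ^ n * 2 ^ n / 4 ≤ (G.card : ℝ) ^ 2 := by
    have := pow_le_pow_left₀ (by positivity) hGcard 2
    linarith
  calc 4 ^ n * τ ≤ 4 * (M * P.card) * τ := by
        gcongr
        linarith
    _ = 4 * P.card * (M * τ) := by ring
    _ ≤ 4 * P.card * (18 * q) := by gcongr
    _ = 72 * q * P.card := by ring

theorem two_mul_sin_half_pos {x : ℝ} (hx : 0 < x) (hxπ : x ≤ π) : 0 < 2 * sin (x / 2) :=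
  mul_pos two_pos (sin_pos_of_pos_of_lt_pi (by linarith) (by linarith))

theorem inv_le_sfun {x : ℝ} (hx : 0 < x) (hxπ : x ≤ π) : x⁻¹ ≤ sfun x :=
  inv_anti₀ (two_mul_sin_half_pos hx hxπ) (by linarith [sin_le (show 0 ≤ x / 2 by linarith)])

theorem half_le_sfun {x : ℝ} (hx : 0 < x) (hxπ : x ≤ π) : 1 / 2 ≤ sfun x := by
  rw [one_div]
  exact inv_anti₀ (two_mul_sin_half_pos hx hxπ) (by linarith [sin_le_one (x / 2)])

theorem sfun_le {x : ℝ} (hx : 0 < x) (hxπ : x ≤ π) : sfun x ≤ 2 * (1 / x) := by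
  have h := mul_le_sin (x := x / 2) (by linarith) (by linarith)
  have h2 : x / 2 ≤ 2 * sin (x / 2) := by
    have h3 : 1 / 2 ≤ 2 / π := by
      rw [div_le_div_iff₀ two_pos pi_pos]
      linarith [pi_le_four]
    nlinarith
  calc sfun x ≤ (x / 2)⁻¹ := inv_anti₀ (by linarith) h2
    _ = 2 * (1 / x) := by rw [inv_div]; ring

theorem two_mul_sin_half_mul_sum_cos (m : ℕ) (x : ℝ) :
    2 * sin (x / 2) * ∑ k ∈ Finset.range (m + 1), cos (k * x) =
      sin (x / 2) + sin ((m + 1 / 2) * x) := by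
  induction m with
  | zero =>
    simp only [zero_add, Finset.sum_range_one, Nat.cast_zero, zero_mul, cos_zero]
    ring_nf
  | succ m ih =>
    rw [Finset.sum_range_succ, mul_add, ih]
    have h1 : (m + 1 / 2 : ℝ) * x = (m + 1 : ℕ) * x - x / 2 := by push_cast; ring
    have h2 : (((m + 1 : ℕ) : ℝ) + 1 / 2) * x = (m + 1 : ℕ) * x + x / 2 := by ring
    rw [h1, h2, sin_sub, sin_add]
    ring

theorem abs_sum_cos_sub_half_le {x : ℝ} (hx : 0 < x) (hxπ : x ≤ π) (m : ℕ) :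
    |∑ k ∈ Finset.range (m + 1), cos (k * x) - 1 / 2| ≤ sfun x := by
  have hpos := two_mul_sin_half_pos hx hxπ
  have h : ∑ k ∈ Finset.range (m + 1), cos (k * x) - 1 / 2 = sin ((m + 1 / 2) * x) * sfun x := by
    rw [sfun, ← div_eq_mul_inv, eq_div_iff hpos.ne']
    linarith [two_mul_sin_half_mul_sum_cos m x]
  have hs : 0 < sfun x := inv_pos.2 hpos
  rw [h, abs_mul, abs_of_pos hs]
  exact mul_le_of_le_one_left hs.le (abs_sin_le_one _)

theorem abs_gB_sub_half_le {x : ℝ} (hx : 0 < x) (hxπ : x ≤ π) (m : ℕ) (e : Fin (m + 1) → Bool) :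
    |gB m e x - 1 / 2| ≤
      |∑ k : Fin (m + 1), boolSign (e k) * cos ((k : ℕ) * x)| / 2 + sfun x / 2 + 1 / 4 := by
  have h : gB m e x - 1 / 2 = (∑ k : Fin (m + 1), boolSign (e k) * cos ((k : ℕ) * x)) / 2 +
      (∑ k ∈ Finset.range (m + 1), cos (k * x) - 1 / 2) / 2 - 1 / 4 := by
    rw [← Fin.sum_univ_eq_sum_range (fun k => cos (k * x)), gB]
    have h1 : ∑ k : Fin (m + 1), (if e k then (1 : ℝ) else 0) * cos ((k : ℕ) * x) =
        (∑ k : Fin (m + 1), boolSign (e k) * cos ((k : ℕ) * x) +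
          ∑ k : Fin (m + 1), cos ((k : ℕ) * x)) / 2 := by
      rw [← Finset.sum_add_distrib, Finset.sum_div]
      refine Finset.sum_congr rfl fun k _ => ?_
      cases e k <;> simp
    rw [h1]
    ring
  have h2 := abs_le.1 (abs_sum_cos_sub_half_le hx hxπ m)
  have h3 := le_abs_self (∑ k : Fin (m + 1), boolSign (e k) * cos ((k : ℕ) * x))
  have h4 := neg_abs_le (∑ k : Fin (m + 1), boolSign (e k) * cos ((k : ℕ) * x))
  rw [h, abs_le]
  constructor <;> linarith

/-- The sequence of Booleans with `u` at the even places, the negation of `v` at the odd places,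
and the value `w` afterwards. -/
def interleave {n : ℕ} (u v : Fin n → Bool) (w : Bool) (k : ℕ) : Bool :=
  if h : k / 2 < n then (if k % 2 = 0 then u ⟨k / 2, h⟩ else !v ⟨k / 2, h⟩) else w

theorem interleave_two_mul {n : ℕ} (u v : Fin n → Bool) (w : Bool) (i : Fin n) :
    interleave u v w (2 * i) = u i := by
  simp [interleave]

theorem interleave_two_mul_add_one {n : ℕ} (u v : Fin n → Bool) (w : Bool) (i : Fin n) :
    interleave u v w (2 * i + 1) = !v i := by
  have h : (2 * (i : ℕ) + 1) / 2 = i := by omega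
  simp [interleave, h]

theorem interleave_last {n : ℕ} (u v : Fin n → Bool) (w : Bool) :
    interleave u v w (2 * n) = w := by
  simp [interleave]

theorem sum_range_two_mul (f : ℕ → ℝ) (n : ℕ) :
    ∑ k ∈ Finset.range (2 * n), f k = ∑ i : Fin n, (f (2 * i) + f (2 * i + 1)) := by
  rw [Fin.sum_univ_eq_sum_range (fun i => f (2 * i) + f (2 * i + 1))]
  induction n with
  | zero => simp
  | succ n ih =>
    rw [Finset.sum_range_succ, ← ih, show 2 * (n + 1) = 2 * n + 1 + 1 by ring,
      Finset.sum_range_succ, Finset.sum_range_succ, add_assoc]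

theorem sum_boolSign_interleave {n : ℕ} (u v : Fin n → Bool) (w : Bool) (a : ℕ → ℝ) :
    ∑ k ∈ Finset.range (2 * n), boolSign (interleave u v w k) * a k =
      ∑ i, boolSign (u i) * a (2 * i) - ∑ i, boolSign (v i) * a (2 * i + 1) := by
  rw [sum_range_two_mul, ← Finset.sum_sub_distrib]
  refine Finset.sum_congr rfl fun i _ => ?_
  rw [interleave_two_mul, interleave_two_mul_add_one, boolSign_not]
  ring

theorem abs_gB_interleave_sub_half_lt {n m : ℕ} (hm : m + 1 = 2 * n ∨ m + 1 = 2 * n + 1) {x : ℝ}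
    (hx : 0 < x) (hx4 : x ≤ 1 / 4) (u v : Fin n → Bool) (w : Bool)
    (huv : |∑ i, boolSign (u i) * cos ((2 * i : ℕ) * x) -
      ∑ i, boolSign (v i) * cos ((2 * i + 1 : ℕ) * x)| ≤ 1 / x / 2) :
    |gB m (fun k => interleave u v w k) x - 1 / 2| < sfun x := by
  have hxπ : x ≤ π := by linarith [pi_gt_three]
  have hs := inv_le_sfun hx hxπ
  rw [← one_div] at hs
  have h4 : 4 ≤ 1 / x := by rw [le_div_iff₀ hx]; linarith
  refine (abs_gB_sub_half_le hx hxπ m _).trans_lt ?_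
  rw [Fin.sum_univ_eq_sum_range (fun k => boolSign (interleave u v w k) * cos (k * x))]
  rw [← sum_boolSign_interleave u v w (fun k => cos (k * x))] at huv
  suffices |∑ k ∈ Finset.range (m + 1), boolSign (interleave u v w k) * cos (k * x)| ≤
      1 / x / 2 + 1 by linarith
  rcases hm with hm | hm
  · rw [hm]
    linarith
  · rw [hm, Finset.sum_range_succ]
    refine (abs_add_le _ _).trans (add_le_add huv ?_)
    rw [abs_mul]
    refine mul_le_one₀ ?_ (abs_nonneg _) (abs_cos_le_one _)
    cases interleave u v w (2 * n) <;> simp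

/-- The proportion of outcomes for which `x` belongs to `E(g)`. -/
noncomputable def hitProb (m : ℕ) (x : ℝ) : ℝ :=
  (({e | |gB m e x - 1 / 2| < sfun x} : Finset (Fin (m + 1) → Bool)).card : ℝ) / 2 ^ (m + 1)

theorem hitProb_nonneg (m : ℕ) (x : ℝ) : 0 ≤ hitProb m x := by
  unfold hitProb
  positivity

theorem hitProb_le_one (m : ℕ) (x : ℝ) : hitProb m x ≤ 1 := by
  refine div_le_one_of_le₀ ?_ (by positivity)
  have h := Finset.card_le_univ ({e | |gB m e x - 1 / 2| < sfun x} : Finset (Fin (m + 1) → Bool))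
  rw [Fintype.card_fun, Fintype.card_bool, Fintype.card_fin] at h
  exact_mod_cast h

theorem hitProb_le {m : ℕ} (hm : 2 ≤ m) {x : ℝ} (hx : 0 < x) (hxπ : x ≤ π) :
    hitProb m x ≤ 36 / √m * (1 / x) := by
  have hm' : (2 : ℝ) ≤ m := by exact_mod_cast hm
  have h := card_sum_abs_lt_le (fun k : Fin (m + 1) => cos ((k : ℕ) * x)) (1 / 2)
    (half_le_sfun hx hxπ) (n := (m + 2) / 4) (by omega) (le_card_half_le_abs_cos m x)
  rw [Fintype.card_fin] at h
  have hsq : √m / 3 ≤ √((m + 2) / 4 : ℕ) := by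
    refine Real.le_sqrt_of_sq_le ?_
    rw [div_pow, Real.sq_sqrt (by linarith), div_le_iff₀ (by norm_num)]
    have : m ≤ (m + 2) / 4 * 3 ^ 2 := by omega
    exact_mod_cast this
  have hsm : 0 < √(m : ℝ) := Real.sqrt_pos.2 (by linarith)
  have hs : 0 ≤ sfun x := by linarith [half_le_sfun hx hxπ]
  unfold hitProb
  rw [div_le_iff₀ (by positivity)]
  calc _ ≤ 6 * sfun x * 2 ^ (m + 1) / √((m + 2) / 4 : ℕ) := h
    _ ≤ 6 * (2 * (1 / x)) * 2 ^ (m + 1) / (√m / 3) := by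
        gcongr
        exact sfun_le hx hxπ
    _ = 36 / √m * (1 / x) * 2 ^ (m + 1) := by
        field_simp
        norm_num

theorem le_hitProb {m : ℕ} (hm : 1 ≤ m) {x : ℝ} (hx : 0 < x) (hx4 : x ≤ 1 / 4)
    (hxm : 1 / x ≤ √m) (hxm' : 64 * (m * x ^ 4) ≤ 1) :
    1 / (72 * √m) * (1 / x) ≤ hitProb m x := by
  have hm' : (1 : ℝ) ≤ m := by exact_mod_cast hm
  have hsm : 0 < √(m : ℝ) := Real.sqrt_pos.2 (by linarith)
  set n := (m + 1) / 2 with hn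
  have hnm : (n : ℝ) ≤ m := by exact_mod_cast (show n ≤ m by omega)
  set P : Finset ((Fin n → Bool) × (Fin n → Bool)) :=
    {p | |∑ i, boolSign (p.1 i) * cos ((2 * i : ℕ) * x) -
      ∑ i, boolSign (p.2 i) * cos ((2 * i + 1 : ℕ) * x)| ≤ 1 / x / 2} with hP
  have hcard : 4 ^ n * (1 / x) ≤ 72 * √m * (P.card : ℝ) := by
    refine card_pairs_abs_boolSign_sum_sub_le (fun i : Fin n => cos ((2 * i : ℕ) * x))
      (fun i : Fin n => cos ((2 * i + 1 : ℕ) * x)) (x := x) (fun i => abs_cos_le_one _) ?_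
      (by positivity) hxm ?_ ?_
    · intro i
      refine (abs_cos_sub_cos_le _ _).trans_eq ?_
      rw [← sub_mul]
      push_cast
      rw [show (2 * (i : ℝ) - (2 * i + 1)) * x = -x by ring, abs_neg, abs_of_pos hx]
    · rwa [Real.sq_sqrt (by linarith)]
    · rw [div_pow, le_div_iff₀ (by positivity)]
      calc 64 * (n * x ^ 2) * x ^ 2 = 64 * (n * x ^ 4) := by ring
        _ ≤ 64 * (m * x ^ 4) := by gcongr
        _ ≤ 1 ^ 2 := by linarith
  set E : Finset (Fin (m + 1) → Bool) := {e | |gB m e x - 1 / 2| < sfun x} with hE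
  have hmem (hmn : m + 1 = 2 * n ∨ m + 1 = 2 * n + 1) (p) (hp : p ∈ P) (w : Bool) :
      (fun k : Fin (m + 1) => interleave p.1 p.2 w k) ∈ E :=
    Finset.mem_filter.2 ⟨Finset.mem_univ _,
      abs_gB_interleave_sub_half_lt hmn hx hx4 _ _ w (Finset.mem_filter.1 hp).2⟩
  have hinj (hmn : 2 * n ≤ m + 1) (p p' : (Fin n → Bool) × (Fin n → Bool)) (w w' : Bool)
      (h : (fun k : Fin (m + 1) => interleave p.1 p.2 w k) =
        fun k : Fin (m + 1) => interleave p'.1 p'.2 w' k) : p = p' := by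
    refine Prod.ext (funext fun i => ?_) (funext fun i => ?_)
    · have := congrFun h ⟨2 * i, by omega⟩
      simpa only [interleave_two_mul] using this
    · have := congrFun h ⟨2 * i + 1, by omega⟩
      simpa only [interleave_two_mul_add_one, Bool.not_inj_iff] using this
  have hPE : 2 ^ (m + 1) * P.card ≤ 4 ^ n * E.card := by
    rcases (show m + 1 = 2 * n ∨ m + 1 = 2 * n + 1 by omega) with hmn | hmn
    · rw [show 2 ^ (m + 1) = 4 ^ n by rw [hmn, pow_mul]; rfl]
      refine Nat.mul_le_mul_left _ (Finset.card_le_card_of_injOn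
        (fun p => fun k : Fin (m + 1) => interleave p.1 p.2 true k)
        (fun p hp => hmem (.inl hmn) p hp true) fun p _ p' _ h => hinj hmn.ge p p' _ _ h)
    · rw [show 2 ^ (m + 1) = 4 ^ n * 2 by rw [hmn, pow_succ, pow_mul]; rfl, mul_assoc]
      refine Nat.mul_le_mul_left _ ?_
      rw [mul_comm, ← Fintype.card_bool, ← Finset.card_univ, ← Finset.card_product]
      refine Finset.card_le_card_of_injOn
        (fun p => fun k : Fin (m + 1) => interleave p.1.1 p.1.2 p.2 k)
        (fun p hp => hmem (.inr hmn) p.1 (Finset.mem_product.1 hp).1 p.2) fun p _ p' _ h => ?_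
      refine Prod.ext (hinj (by omega) _ _ _ _ h) ?_
      have := congrFun h ⟨2 * n, by omega⟩
      simpa only [interleave_last] using this
  have hPE' : (2 : ℝ) ^ (m + 1) * P.card ≤ 4 ^ n * E.card := by exact_mod_cast hPE
  change _ ≤ (E.card : ℝ) / 2 ^ (m + 1)
  rw [le_div_iff₀ (by positivity), one_div_mul_eq_div, div_mul_eq_mul_div,
    div_le_iff₀ (by positivity)]
  refine le_of_mul_le_mul_left ?_ (show (0 : ℝ) < 4 ^ n by positivity)
  calc 4 ^ n * (1 / x * 2 ^ (m + 1)) = (4 ^ n * (1 / x)) * 2 ^ (m + 1) := by ring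
    _ ≤ (72 * √m * P.card) * 2 ^ (m + 1) := by gcongr
    _ = 72 * √m * (2 ^ (m + 1) * P.card) := by ring
    _ ≤ 72 * √m * (4 ^ n * E.card) := by gcongr
    _ = 4 ^ n * (E.card * (72 * √m)) := by ring

theorem measurable_sfun : Measurable sfun := by
  unfold sfun
  fun_prop

theorem measurable_gB (m : ℕ) (e : Fin (m + 1) → Bool) : Measurable (gB m e) := by
  unfold gB
  fun_prop

theorem measurableSet_hit (m : ℕ) (e : Fin (m + 1) → Bool) :
    MeasurableSet {x | |gB m e x - 1 / 2| < sfun x} :=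
  measurableSet_lt ((measurable_gB m e).sub_const _).abs measurable_sfun

theorem hitProb_eq_sum_indicator (m : ℕ) :
    hitProb m = fun x => (∑ e : Fin (m + 1) → Bool,
      {x | |gB m e x - 1 / 2| < sfun x}.indicator (1 : ℝ → ℝ) x) / 2 ^ (m + 1) := by
  funext x
  simp only [hitProb, Finset.card_filter, Set.indicator_apply, Set.mem_ofPred_eq, Pi.one_apply]
  push_cast
  rfl

theorem measurable_hitProb (m : ℕ) : Measurable (hitProb m) := by
  rw [hitProb_eq_sum_indicator]
  exact (Finset.measurable_fun_sum _ fun e _ =>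
    measurable_one.indicator (measurableSet_hit m e)).div_const _

theorem integrableOn_hitProb (m : ℕ) {s : Set ℝ} (hs : volume s ≠ ⊤) :
    IntegrableOn (hitProb m) s := by
  refine Measure.integrableOn_of_bounded (M := 1) hs (measurable_hitProb m).aestronglyMeasurable
    (.of_forall fun x => ?_)
  rw [Real.norm_of_nonneg (hitProb_nonneg m x)]
  exact hitProb_le_one m x

theorem sum_volume_div_eq_integral_hitProb (m : ℕ) :
    (∑ e : Fin (m + 1) → Bool,
      (volume {x ∈ Set.Ioc (0 : ℝ) π | |gB m e x - 1 / 2| < sfun x}).toReal) / 2 ^ (m + 1) =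
      ∫ x in Set.Ioc 0 π, hitProb m x := by
  rw [hitProb_eq_sum_indicator, integral_div, integral_finsetSum]
  · congr 1
    refine Finset.sum_congr rfl fun e _ => ?_
    rw [integral_indicator_one (measurableSet_hit m e), measureReal_restrict_apply
      (measurableSet_hit m e), measureReal_def, Set.inter_comm]
    rfl
  · intro e _
    exact (integrable_const (1 : ℝ)).indicator (measurableSet_hit m e)

theorem integrableOn_Ioc_const_mul_one_div (c : ℝ) {a b : ℝ} (ha : 0 < a) :
    IntegrableOn (fun x => c * (1 / x)) (Set.Ioc a b) := by
  refine IntegrableOn.mono_set (ContinuousOn.integrableOn_Icc ?_) Set.Ioc_subset_Icc_self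
  exact continuousOn_const.mul (continuousOn_const.div continuousOn_id
    fun x hx => (ha.trans_le hx.1).ne')

theorem setIntegral_Ioc_const_mul_one_div (c : ℝ) {a b : ℝ} (ha : 0 < a) (hab : a ≤ b) :
    ∫ x in Set.Ioc a b, c * (1 / x) = c * log (b / a) := by
  rw [integral_const_mul, ← intervalIntegral.integral_of_le hab,
    integral_one_div_of_pos ha (ha.trans_le hab)]

theorem integral_hitProb_le {m : ℕ} (hm : 3 ≤ m) :
    ∫ x in Set.Ioc 0 π, hitProb m x ≤ 109 * log m / √m := by
  have hm' : (3 : ℝ) ≤ m := by exact_mod_cast hm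
  have hm0 : (0 : ℝ) < m := by linarith
  have hlog : 1 ≤ log m := by
    rw [Real.le_log_iff_exp_le hm0]
    linarith [exp_one_lt_d9]
  have hpos : (0 : ℝ) < 1 / m := by positivity
  have hle : 1 / (m : ℝ) ≤ π := by
    rw [div_le_iff₀ hm0]
    nlinarith [pi_gt_three]
  have hsm : 0 < √(m : ℝ) := Real.sqrt_pos.2 hm0
  rw [← Set.Ioc_union_Ioc_eq_Ioc hpos.le hle, setIntegral_union (Set.Ioc_disjoint_Ioc_of_le le_rfl)
    measurableSet_Ioc (integrableOn_hitProb m measure_Ioc_lt_top.ne)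
    (integrableOn_hitProb m measure_Ioc_lt_top.ne)]
  have h1 : ∫ x in Set.Ioc 0 (1 / (m : ℝ)), hitProb m x ≤ 1 / m := by
    calc ∫ x in Set.Ioc 0 (1 / (m : ℝ)), hitProb m x ≤ ∫ _x in Set.Ioc 0 (1 / (m : ℝ)), (1 : ℝ) :=
          setIntegral_mono_on (integrableOn_hitProb m measure_Ioc_lt_top.ne)
            (integrableOn_const measure_Ioc_lt_top.ne) measurableSet_Ioc
            fun x _ => hitProb_le_one m x
      _ = 1 / m := by simp
  have h2 : ∫ x in Set.Ioc (1 / (m : ℝ)) π, hitProb m x ≤ 36 / √m * (3 * log m) := by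
    calc ∫ x in Set.Ioc (1 / (m : ℝ)) π, hitProb m x
        ≤ ∫ x in Set.Ioc (1 / (m : ℝ)) π, 36 / √m * (1 / x) :=
          setIntegral_mono_on (integrableOn_hitProb m measure_Ioc_lt_top.ne)
            (integrableOn_Ioc_const_mul_one_div _ hpos) measurableSet_Ioc
            fun x hx => hitProb_le (by omega) (hpos.trans hx.1) hx.2
      _ = 36 / √m * log (π / (1 / m)) := setIntegral_Ioc_const_mul_one_div _ hpos hle
      _ ≤ 36 / √m * (3 * log m) := by
          gcongr
          rw [show (3 : ℝ) * log m = log ((m : ℝ) ^ 3) by rw [Real.log_pow]; norm_num]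
          refine Real.log_le_log (by positivity) ?_
          rw [div_div_eq_mul_div, div_one]
          nlinarith [pi_le_four, mul_le_mul hm' hm' (by norm_num) hm0.le]
  have h3 : 1 / (m : ℝ) ≤ log m / √m := by
    have : √(m : ℝ) ≤ m := by
      rw [Real.sqrt_le_left hm0.le]
      nlinarith
    gcongr
  calc _ ≤ log m / √m + 36 / √m * (3 * log m) := by linarith
    _ = 109 * log m / √m := by ring

theorem le_integral_hitProb {m : ℕ} (hm : 4 ^ 8 ≤ m) :
    1 / 576 * log m / √m ≤ ∫ x in Set.Ioc 0 π, hitProb m x := by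
  have hm' : (4 : ℝ) ^ 8 ≤ m := by exact_mod_cast hm
  have hm0 : (0 : ℝ) < m := by linarith
  set q := √√(m : ℝ) with hq
  have hq2 : q ^ 2 = √m := Real.sq_sqrt (Real.sqrt_nonneg _)
  have hq4 : q ^ 4 = m := by
    rw [show q ^ 4 = (q ^ 2) ^ 2 by ring, hq2, Real.sq_sqrt hm0.le]
  have hq16 : 16 ≤ q := by
    refine Real.le_sqrt_of_sq_le (Real.le_sqrt_of_sq_le ?_)
    linarith
  have hq0 : 0 < q := by linarith
  have ha : 0 < 1 / q ^ 2 := by positivity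
  have hab : 1 / q ^ 2 ≤ 1 / (4 * q) := by
    gcongr
    nlinarith
  have hb : 1 / (4 * q) ≤ 1 / 4 := by
    gcongr
    linarith
  have hlog : log m / 8 ≤ log (1 / (4 * q) / (1 / q ^ 2)) := by
    have h1 : 1 / (4 * q) / (1 / q ^ 2) = q / 4 := by field_simp
    rw [h1, div_le_iff₀ (by norm_num), mul_comm, ← hq4,
      show (8 : ℝ) * log (q / 4) = log ((q / 4) ^ 8) by rw [Real.log_pow]; norm_num]
    refine Real.log_le_log (by positivity) ?_
    rw [div_pow, le_div_iff₀ (by norm_num), show q ^ 8 = q ^ 4 * q ^ 4 by ring]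
    gcongr
    rw [hq4]
    linarith
  calc 1 / 576 * log m / √m = 1 / (72 * √m) * (log m / 8) := by ring
    _ ≤ 1 / (72 * √m) * log (1 / (4 * q) / (1 / q ^ 2)) := by gcongr
    _ = ∫ x in Set.Ioc (1 / q ^ 2) (1 / (4 * q)), 1 / (72 * √m) * (1 / x) :=
        (setIntegral_Ioc_const_mul_one_div _ ha hab).symm
    _ ≤ ∫ x in Set.Ioc (1 / q ^ 2) (1 / (4 * q)), hitProb m x := by
        refine setIntegral_mono_on (integrableOn_Ioc_const_mul_one_div _ ha)
          (integrableOn_hitProb m measure_Ioc_lt_top.ne) measurableSet_Ioc fun x hx => ?_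
        have hx0 := ha.trans hx.1
        refine le_hitProb (by omega) hx0 (hx.2.trans hb) ?_ ?_
        · rw [← hq2, div_le_iff₀ hx0, mul_comm, ← div_le_iff₀ (by positivity)]
          exact hx.1.le
        · have hx4 : x ^ 4 ≤ (1 / (4 * q)) ^ 4 := pow_le_pow_left₀ hx0.le hx.2 4
          have h2 : (1 / (4 * q)) ^ 4 = 1 / (256 * m) := by rw [← hq4]; ring
          rw [h2, le_div_iff₀ (by positivity)] at hx4
          nlinarith [pow_pos hx0 4]
    _ ≤ ∫ x in Set.Ioc 0 π, hitProb m x :=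
        setIntegral_mono_set (integrableOn_hitProb m measure_Ioc_lt_top.ne)
          (.of_forall fun x => hitProb_nonneg m x)
          (Set.Ioc_subset_Ioc ha.le (by linarith [pi_gt_three])).eventuallyLE

/-- There are constants `c, C > 0` and `m₀ ∈ ℕ` such that for all `m ≥ m₀`: if `g ~ G_m`
then `c log m / √m ≤ E |E(g)| ≤ C log m / √m`, where
`E(g) = {x ∈ (0,π] : |g(x) - 1/2| < s(x)}`, `|·|` is Lebesgue measure and the expectation
is the average over all `2^(m+1)` outcomes of the Bernoulli variables. -/
theorem stmt13 :
    ∃ c C : ℝ, 0 < c ∧ 0 < C ∧ ∃ m₀ : ℕ, ∀ m : ℕ, m₀ ≤ m →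
      c * Real.log m / Real.sqrt m ≤
        (∑ e : Fin (m + 1) → Bool,
          (volume {x ∈ Set.Ioc (0 : ℝ) π | |gB m e x - 1 / 2| < sfun x}).toReal) / 2 ^ (m + 1) ∧
      (∑ e : Fin (m + 1) → Bool,
          (volume {x ∈ Set.Ioc (0 : ℝ) π | |gB m e x - 1 / 2| < sfun x}).toReal) / 2 ^ (m + 1) ≤
        C * Real.log m / Real.sqrt m := by
  refine ⟨1 / 576, 109, by norm_num, by norm_num, 4 ^ 8, fun m hm => ?_⟩
  rw [sum_volume_div_eq_integral_hitProb]
  exact ⟨le_integral_hitProb hm, integral_hitProb_le (le_trans (by norm_num) hm)⟩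
end
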